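/- For every M > 0 there exists a constant C > 0 with the following property. Let T > 0, let u : [0,T] × ℝ² → ℝ be such that t ↦ u(t,·) is a continuously differentiable map from [0,T] into the Schwartz space 𝒮(ℝ²), and let Ψ : ℝ × ℝ² → ℝ be smooth with all derivatives up to second order bounded. Set G := ∂ₜΨ + ∂ₓ(∂ₓ² + ∂ᵧ²)Ψ + ½∂ₓ(Ψ²), and suppose u satisfies ∂ₜu + ∂ₓ(∂ₓ² + ∂ᵧ²)u + ½∂ₓ(u²) + ∂ₓ(uΨ) + G = 0 pointwise on [0,T] × ℝ². If ‖u(0)‖_{H¹(ℝ²)} ≤ M, sup_{t,x,y} |Ψ| ≤ M, sup_{t,x,y} |∂ₜΨ| ≤ M, and sup_{t∈[0,T]} ‖G(t,·)‖_{H²(ℝ²)} ≤ M, then ‖u(t)‖_{H¹(ℝ²)} ≤ C·exp(C·t) for all t ∈ [0,T]. -/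

import Mathlib

open MeasureTheory

noncomputable section

/-- Partial derivative in the first spatial variable. -/
def pdx (f : ℝ × ℝ → ℝ) (p : ℝ × ℝ) : ℝ := deriv (fun x => f (x, p.2)) p.1

/-- Partial derivative in the second spatial variable. -/
def pdy (f : ℝ × ℝ → ℝ) (p : ℝ × ℝ) : ℝ := deriv (fun y => f (p.1, y)) p.2

/-- The background source term
`G = ∂ₜΨ + ∂ₓ(∂ₓ² + ∂ᵧ²)Ψ + ½∂ₓ(Ψ²)` at time `t`. -/
def bgG (Ψ : ℝ × (ℝ × ℝ) → ℝ) (t : ℝ) (q : ℝ × ℝ) : ℝ :=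
  deriv (fun s => Ψ (s, q)) t +
    pdx (pdx (pdx fun q' => Ψ (t, q'))) q +
    pdx (pdy (pdy fun q' => Ψ (t, q'))) q +
    (1 / 2) * pdx (fun q' => Ψ (t, q') ^ 2) q

/-- The `H¹(ℝ²)` norm, `‖v‖_{H¹}² = ‖v‖_{L²}² + ‖∇v‖_{L²}²`. -/
def sobH1 (f : ℝ × ℝ → ℝ) : ℝ :=
  Real.sqrt ((eLpNorm f 2 volume).toReal ^ 2 +
    (eLpNorm (pdx f) 2 volume).toReal ^ 2 +
    (eLpNorm (pdy f) 2 volume).toReal ^ 2)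

open scoped ContDiff

/-! ### Partial derivatives of smooth functions -/

lemma pdx_eq_fderiv {f : ℝ × ℝ → ℝ} {p : ℝ × ℝ} (hf : DifferentiableAt ℝ f p) :
    pdx f p = fderiv ℝ f p (1, 0) := by
  have h1 : HasDerivAt (fun x : ℝ => ((x, p.2) : ℝ × ℝ)) (1, 0) p.1 :=
    (hasDerivAt_id p.1).prodMk (hasDerivAt_const p.1 p.2)
  exact (hf.hasFDerivAt.comp_hasDerivAt_of_eq p.1 h1 rfl).deriv

lemma pdy_eq_fderiv {f : ℝ × ℝ → ℝ} {p : ℝ × ℝ} (hf : DifferentiableAt ℝ f p) :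
    pdy f p = fderiv ℝ f p (0, 1) := by
  have h1 : HasDerivAt (fun y : ℝ => ((p.1, y) : ℝ × ℝ)) (0, 1) p.2 :=
    (hasDerivAt_const p.2 p.1).prodMk (hasDerivAt_id p.2)
  exact (hf.hasFDerivAt.comp_hasDerivAt_of_eq p.2 h1 rfl).deriv

lemma hasDerivAt_pdx {f : ℝ × ℝ → ℝ} (hf : ContDiff ℝ ∞ f) (p : ℝ × ℝ) :
    HasDerivAt (fun x => f (x, p.2)) (pdx f p) p.1 := by
  have : Differentiable ℝ f := hf.differentiable (by simp)
  exact (by fun_prop : DifferentiableAt ℝ (fun x => f (x, p.2)) p.1).hasDerivAt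

lemma hasDerivAt_pdy {f : ℝ × ℝ → ℝ} (hf : ContDiff ℝ ∞ f) (p : ℝ × ℝ) :
    HasDerivAt (fun y => f (p.1, y)) (pdy f p) p.2 := by
  have : Differentiable ℝ f := hf.differentiable (by simp)
  exact (by fun_prop : DifferentiableAt ℝ (fun y => f (p.1, y)) p.2).hasDerivAt

lemma pdx_eq {f : ℝ × ℝ → ℝ} (hf : ContDiff ℝ ∞ f) : pdx f = fun p => fderiv ℝ f p (1, 0) :=
  funext fun _ => pdx_eq_fderiv (hf.differentiable (by simp) _)

lemma pdy_eq {f : ℝ × ℝ → ℝ} (hf : ContDiff ℝ ∞ f) : pdy f = fun p => fderiv ℝ f p (0, 1) :=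
  funext fun _ => pdy_eq_fderiv (hf.differentiable (by simp) _)

lemma contDiff_pdx {f : ℝ × ℝ → ℝ} (hf : ContDiff ℝ ∞ f) : ContDiff ℝ ∞ (pdx f) := by
  rw [pdx_eq hf]
  exact (hf.fderiv_right (m := ∞) (by simp)).clm_apply contDiff_const

lemma contDiff_pdy {f : ℝ × ℝ → ℝ} (hf : ContDiff ℝ ∞ f) : ContDiff ℝ ∞ (pdy f) := by
  rw [pdy_eq hf]
  exact (hf.fderiv_right (m := ∞) (by simp)).clm_apply contDiff_const

lemma pdx_pdy_comm {f : ℝ × ℝ → ℝ} (hf : ContDiff ℝ ∞ f) : pdx (pdy f) = pdy (pdx f) := by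
  rw [pdx_eq (contDiff_pdy hf), pdy_eq (contDiff_pdx hf), pdx_eq hf, pdy_eq hf]
  funext p
  have hd : DifferentiableAt ℝ (fderiv ℝ f) p :=
    (hf.fderiv_right (m := ∞) (by simp)).differentiable (by simp) p
  have key : ∀ v w : ℝ × ℝ, fderiv ℝ (fun p => fderiv ℝ f p v) p w
      = fderiv ℝ (fderiv ℝ f) p w v := by
    intro v w
    rw [fderiv_clm_apply hd (differentiableAt_const v)]
    simp
  rw [key, key]
  exact (hf.contDiffAt.isSymmSndFDerivAt (by
    rw [minSmoothness_of_isRCLikeNormedField]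
    exact WithTop.coe_le_coe.2 le_top)) _ _

/-! ### The fundamental theorem of calculus on the plane -/

lemma integral_eq_zero_of_hasDerivAt_fst {h h' : ℝ × ℝ → ℝ}
    (hd : ∀ p : ℝ × ℝ, HasDerivAt (fun x => h (x, p.2)) (h' p) p.1)
    (hi : Integrable h) (hi' : Integrable h') : ∫ p, h' p = 0 := by
  have := integral_bilinear_hasLineDerivAt_right_eq_neg_left_of_integrable
    (μ := (volume : Measure (ℝ × ℝ))) (f := fun _ => (1 : ℝ)) (f' := fun _ => (0 : ℝ))
    (g := h) (g' := h') (v := (1, 0)) (B := ContinuousLinearMap.mul ℝ ℝ)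
    (by simp) (by simpa using hi') (by simpa using hi)
    (fun x _ => by simpa [HasLineDerivAt] using hasDerivAt_const (0 : ℝ) (1 : ℝ))
    (fun x _ => by
      have h1 : HasDerivAt (fun s => h (s, x.2)) (h' x) (x.1 + 0) := by simpa using hd x
      have e : ∀ t : ℝ, x + (t, 0) = (x.1 + t, x.2) := fun t => by ext <;> simp
      simpa [HasLineDerivAt, Prod.smul_mk, e] using h1.comp_const_add x.1 0)
  simpa using this

lemma integral_eq_zero_of_hasDerivAt_snd {h h' : ℝ × ℝ → ℝ}
    (hd : ∀ p : ℝ × ℝ, HasDerivAt (fun y => h (p.1, y)) (h' p) p.2)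
    (hi : Integrable h) (hi' : Integrable h') : ∫ p, h' p = 0 := by
  have := integral_bilinear_hasLineDerivAt_right_eq_neg_left_of_integrable
    (μ := (volume : Measure (ℝ × ℝ))) (f := fun _ => (1 : ℝ)) (f' := fun _ => (0 : ℝ))
    (g := h) (g' := h') (v := (0, 1)) (B := ContinuousLinearMap.mul ℝ ℝ)
    (by simp) (by simpa using hi') (by simpa using hi)
    (fun x _ => by simpa [HasLineDerivAt] using hasDerivAt_const (0 : ℝ) (1 : ℝ))
    (fun x _ => by
      have h1 : HasDerivAt (fun s => h (x.1, s)) (h' x) (x.2 + 0) := by simpa using hd x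
      have e : ∀ t : ℝ, x + (0, t) = (x.1, x.2 + t) := fun t => by ext <;> simp
      simpa [HasLineDerivAt, Prod.smul_mk, e] using h1.comp_const_add x.2 0)
  simpa using this

/-! ### The Cauchy–Schwarz inequality for real integrals -/

lemma sq_integral_mul_le {α : Type*} [MeasurableSpace α] {μ : Measure α} {f g : α → ℝ}
    (hf : MemLp f 2 μ) (hg : MemLp g 2 μ) :
    (∫ a, f a * g a ∂μ) ^ 2 ≤ (∫ a, f a ^ 2 ∂μ) * ∫ a, g a ^ 2 ∂μ := by
  have hfg := hf.integrable_mul hg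
  have key : ∀ x : ℝ, 0 ≤ (∫ a, f a ^ 2 ∂μ) * (x * x) + (2 * ∫ a, f a * g a ∂μ) * x
      + ∫ a, g a ^ 2 ∂μ := by
    intro x
    have h0 : 0 ≤ ∫ a, (x * f a + g a) ^ 2 ∂μ := integral_nonneg fun a => sq_nonneg _
    have h1 : ∫ a, (x * f a + g a) ^ 2 ∂μ = ∫ a, (x * x) * f a ^ 2 + (2 * x) * (f a * g a)
        + g a ^ 2 ∂μ := by congr 1; ext a; ring
    rw [h1, integral_add, integral_add, integral_const_mul, integral_const_mul] at h0
    · linarith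
    · exact hf.integrable_sq.const_mul _
    · exact hfg.const_mul _
    · exact (hf.integrable_sq.const_mul _).add (hfg.const_mul _)
    · exact hg.integrable_sq
  have := discrim_le_zero key
  rw [discrim] at this
  nlinarith

lemma eLpNorm_two_toReal_sq {α : Type*} [MeasurableSpace α] {μ : Measure α} {f : α → ℝ}
    (hf : MemLp f 2 μ) : (eLpNorm f 2 μ).toReal ^ 2 = ∫ a, f a ^ 2 ∂μ := by
  have h0 : 0 ≤ ∫ a, f a ^ 2 ∂μ := integral_nonneg fun a => sq_nonneg _
  rw [hf.eLpNorm_eq_integral_rpow_norm (by simp) (by simp), ENNReal.toReal_ofReal (by positivity)]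
  simp only [ENNReal.toReal_ofNat, Real.rpow_ofNat, Real.norm_eq_abs, sq_abs]
  rw [← Real.rpow_natCast, ← Real.rpow_mul h0]
  simp

lemma abs_integral_le_of_abs_le {α : Type*} [MeasurableSpace α] {μ : Measure α} {f g : α → ℝ}
    (hg : Integrable g μ) (h : ∀ a, |f a| ≤ g a) : |∫ a, f a ∂μ| ≤ ∫ a, g a ∂μ := by
  rw [← Real.norm_eq_abs]
  exact norm_integral_le_of_norm_le hg (Filter.Eventually.of_forall h)

/-! ### An interior gradient estimate for the background -/

/-- The truncated paraboloid `(1 - |z|²)₊` on the plane. -/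
def parabolaBump (z : ℝ × ℝ) : ℝ := max 0 (1 - (z.1 ^ 2 + z.2 ^ 2))

lemma continuous_parabolaBump : Continuous parabolaBump := by
  unfold parabolaBump; fun_prop

lemma parabolaBump_nonneg (z : ℝ × ℝ) : 0 ≤ parabolaBump z := le_max_left _ _

lemma norm_le_one_of_parabolaBump_ne_zero {z : ℝ × ℝ} (hz : parabolaBump z ≠ 0) : ‖z‖ ≤ 1 := by
  have h : 0 < 1 - (z.1 ^ 2 + z.2 ^ 2) := by
    by_contra hc
    exact hz (max_eq_left (not_lt.1 hc))
  rw [Prod.norm_def, max_le_iff, Real.norm_eq_abs, Real.norm_eq_abs, abs_le_one_iff_mul_self_le_one,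
    abs_le_one_iff_mul_self_le_one]
  constructor <;> nlinarith [sq_nonneg z.1, sq_nonneg z.2]

lemma integrable_mul_parabolaBump_pow {f : ℝ × ℝ → ℝ} (hf : Continuous f) {n : ℕ} (hn : n ≠ 0) :
    Integrable fun z => f z * parabolaBump z ^ n := by
  refine (hf.mul (continuous_parabolaBump.pow n)).integrable_of_hasCompactSupport ?_
  refine HasCompactSupport.intro (isCompact_closedBall (0 : ℝ × ℝ) 1) fun z hz => ?_
  have : parabolaBump z = 0 := by
    by_contra hc
    exact hz (by simpa using norm_le_one_of_parabolaBump_ne_zero hc)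
  simp [this, hn]

lemma integrable_parabolaBump_pow {n : ℕ} (hn : n ≠ 0) :
    Integrable fun z => parabolaBump z ^ n := by
  simpa using integrable_mul_parabolaBump_pow (f := fun _ => (1 : ℝ)) continuous_const hn

lemma integral_parabolaBump_sq_pos : 0 < ∫ z, parabolaBump z ^ 2 := by
  refine (continuous_parabolaBump.pow 2).integral_pos_of_hasCompactSupport_nonneg_nonzero
    (x := 0) ?_ (fun z => sq_nonneg _) (by simp [parabolaBump])
  refine HasCompactSupport.intro (isCompact_closedBall (0 : ℝ × ℝ) 1) fun z hz => ?_
  have : parabolaBump z = 0 := by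
    by_contra hc
    exact hz (by simpa using norm_le_one_of_parabolaBump_ne_zero hc)
  simp [this]

lemma hasDerivAt_max_zero_pow (n : ℕ) (s : ℝ) :
    HasDerivAt (fun s : ℝ => max 0 s ^ (n + 2)) ((n + 2) * max 0 s ^ (n + 1)) s := by
  rcases lt_trichotomy s 0 with hs | rfl | hs
  · have : (fun s : ℝ => max 0 s ^ (n + 2)) =ᶠ[nhds s] fun _ => 0 := by
      filter_upwards [Iio_mem_nhds hs] with x hx
      simp [max_eq_left (le_of_lt (Set.mem_Iio.1 hx))]
    simpa [max_eq_left hs.le] using (hasDerivAt_const s (0 : ℝ)).congr_of_eventuallyEq this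
  · rw [hasDerivAt_iff_isLittleO_nhds_zero]
    simp only [zero_add, max_self, ne_eq, Nat.add_eq_zero_iff, OfNat.ofNat_ne_zero, and_false,
      not_false_eq_true, zero_pow, sub_zero, one_ne_zero, mul_zero, smul_zero]
    have h1 : (fun h : ℝ => max 0 h ^ (n + 2)) =O[nhds 0] fun h => h ^ (n + 2) := by
      refine Asymptotics.IsBigO.of_bound 1 (Filter.Eventually.of_forall fun h => ?_)
      rw [norm_pow, norm_pow, one_mul]
      refine pow_le_pow_left₀ (norm_nonneg _) ?_ _
      rw [Real.norm_eq_abs, Real.norm_eq_abs, abs_of_nonneg (le_max_left _ _)]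
      exact max_le (abs_nonneg _) (le_abs_self _)
    refine h1.trans_isLittleO ?_
    simpa using! Asymptotics.isLittleO_pow_pow (𝕜 := ℝ) (m := 1) (n := n + 2) (by lia)
  · have : (fun s : ℝ => max 0 s ^ (n + 2)) =ᶠ[nhds s] fun s => s ^ (n + 2) := by
      filter_upwards [Ioi_mem_nhds hs] with x hx
      simp [max_eq_right (le_of_lt (Set.mem_Ioi.1 hx))]
    simpa [max_eq_right hs.le] using (hasDerivAt_pow (n + 2) s).congr_of_eventuallyEq this

lemma hasDerivAt_parabolaBump_pow_fst (n : ℕ) (z : ℝ × ℝ) :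
    HasDerivAt (fun x => parabolaBump (x, z.2) ^ (n + 2))
      (-(2 * (n + 2)) * z.1 * parabolaBump z ^ (n + 1)) z.1 := by
  have h : HasDerivAt (fun x : ℝ => 1 - (x ^ 2 + z.2 ^ 2)) (-(2 * z.1)) z.1 := by
    simpa using ((hasDerivAt_pow 2 z.1).add_const (z.2 ^ 2)).const_sub 1
  refine ((hasDerivAt_max_zero_pow n _).comp z.1 h).congr_deriv ?_
  simp only [parabolaBump]; ring

lemma hasDerivAt_parabolaBump_pow_snd (n : ℕ) (z : ℝ × ℝ) :
    HasDerivAt (fun y => parabolaBump (z.1, y) ^ (n + 2))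
      (-(2 * (n + 2)) * z.2 * parabolaBump z ^ (n + 1)) z.2 := by
  have h : HasDerivAt (fun y : ℝ => 1 - (z.1 ^ 2 + y ^ 2)) (-(2 * z.2)) z.2 := by
    simpa using ((hasDerivAt_pow 2 z.2).const_add (z.1 ^ 2)).const_sub 1
  refine ((hasDerivAt_max_zero_pow n _).comp z.2 h).congr_deriv ?_
  simp only [parabolaBump]; ring

lemma continuous_comp_add_smul {F : ℝ × ℝ → ℝ} (hF : Continuous F) (p : ℝ × ℝ) (r : ℝ) :
    Continuous fun z : ℝ × ℝ => F (p + r • z) := by fun_prop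

lemma hasDerivAt_comp_add_smul_fst {F : ℝ × ℝ → ℝ} (hF : ContDiff ℝ ∞ F) (p : ℝ × ℝ) (r : ℝ)
    (z : ℝ × ℝ) :
    HasDerivAt (fun x : ℝ => F (p + r • (x, z.2))) (r * pdx F (p + r • z)) z.1 := by
  have h1 : HasDerivAt (fun x : ℝ => p.1 + r * x) r z.1 := by
    simpa using ((hasDerivAt_id z.1).const_mul r).const_add p.1
  have := (hasDerivAt_pdx hF (p + r • z)).comp_of_eq z.1 h1 (by simp)
  rw [mul_comm]
  exact this

lemma hasDerivAt_comp_add_smul_snd {F : ℝ × ℝ → ℝ} (hF : ContDiff ℝ ∞ F) (p : ℝ × ℝ) (r : ℝ)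
    (z : ℝ × ℝ) :
    HasDerivAt (fun y : ℝ => F (p + r • (z.1, y))) (r * pdy F (p + r • z)) z.2 := by
  have h1 : HasDerivAt (fun x : ℝ => p.2 + r * x) r z.2 := by
    simpa using ((hasDerivAt_id z.2).const_mul r).const_add p.2
  have := (hasDerivAt_pdy hF (p + r • z)).comp_of_eq z.2 h1 (by simp)
  rw [mul_comm]
  exact this

lemma integral_pdx_mul_parabolaBump {F : ℝ × ℝ → ℝ} (hF : ContDiff ℝ ∞ F) (p : ℝ × ℝ) (r : ℝ)
    (n : ℕ) :
    ∫ z : ℝ × ℝ, r * pdx F (p + r • z) * parabolaBump z ^ (n + 2)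
      = ∫ z : ℝ × ℝ, 2 * (n + 2) * (z.1 * F (p + r • z)) * parabolaBump z ^ (n + 1) := by
  have c0 := continuous_comp_add_smul hF.continuous p r
  have c1 := continuous_comp_add_smul (contDiff_pdx hF).continuous p r
  have i1 := integrable_mul_parabolaBump_pow (c1.const_mul r) (n := n + 2) (by simp)
  have i2 : Integrable fun z : ℝ × ℝ =>
      2 * (n + 2) * (z.1 * F (p + r • z)) * parabolaBump z ^ (n + 1) :=
    integrable_mul_parabolaBump_pow (by fun_prop) (by simp)
  rw [← sub_eq_zero, ← integral_sub i1 i2]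
  refine integral_eq_zero_of_hasDerivAt_fst
    (h := fun z => F (p + r • z) * parabolaBump z ^ (n + 2)) (fun z => ?_)
    (integrable_mul_parabolaBump_pow c0 (by simp)) (i1.sub i2)
  refine ((hasDerivAt_comp_add_smul_fst hF p r z).mul
    (hasDerivAt_parabolaBump_pow_fst n z)).congr_deriv ?_
  simp only [Prod.mk.eta]; ring

lemma integral_pdy_mul_parabolaBump {F : ℝ × ℝ → ℝ} (hF : ContDiff ℝ ∞ F) (p : ℝ × ℝ) (r : ℝ)
    (n : ℕ) :
    ∫ z : ℝ × ℝ, r * pdy F (p + r • z) * parabolaBump z ^ (n + 2)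
      = ∫ z : ℝ × ℝ, 2 * (n + 2) * (z.2 * F (p + r • z)) * parabolaBump z ^ (n + 1) := by
  have c0 := continuous_comp_add_smul hF.continuous p r
  have c1 := continuous_comp_add_smul (contDiff_pdy hF).continuous p r
  have i1 := integrable_mul_parabolaBump_pow (c1.const_mul r) (n := n + 2) (by simp)
  have i2 : Integrable fun z : ℝ × ℝ =>
      2 * (n + 2) * (z.2 * F (p + r • z)) * parabolaBump z ^ (n + 1) :=
    integrable_mul_parabolaBump_pow (by fun_prop) (by simp)
  rw [← sub_eq_zero, ← integral_sub i1 i2]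
  refine integral_eq_zero_of_hasDerivAt_snd
    (h := fun z => F (p + r • z) * parabolaBump z ^ (n + 2)) (fun z => ?_)
    (integrable_mul_parabolaBump_pow c0 (by simp)) (i1.sub i2)
  refine ((hasDerivAt_comp_add_smul_snd hF p r z).mul
    (hasDerivAt_parabolaBump_pow_snd n z)).congr_deriv ?_
  simp only [Prod.mk.eta]; ring

lemma hasDerivAt_integral_comp_add_smul {v : ℝ × ℝ → ℝ} (hv : ContDiff ℝ ∞ v) (p : ℝ × ℝ)
    (r : ℝ) :
    HasDerivAt (fun r => ∫ z : ℝ × ℝ, v (p + r • z) * parabolaBump z ^ 2)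
      (∫ z : ℝ × ℝ, (z.1 * pdx v (p + r • z) + z.2 * pdy v (p + r • z)) * parabolaBump z ^ 2)
      r := by
  have cx := (contDiff_pdx hv).continuous
  have cy := (contDiff_pdy hv).continuous
  have cb := continuous_parabolaBump
  set H : ℝ × (ℝ × ℝ) → ℝ := fun w =>
    (w.2.1 * pdx v (p + w.1 • w.2) + w.2.2 * pdy v (p + w.1 • w.2)) * parabolaBump w.2 ^ 2 with hH
  have cH : Continuous H := by rw [hH]; fun_prop
  obtain ⟨C, hC⟩ := ((isCompact_Icc (a := r - 1) (b := r + 1)).prod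
    (isCompact_closedBall (0 : ℝ × ℝ) 1)).exists_bound_of_continuousOn cH.continuousOn
  refine (hasDerivAt_integral_of_dominated_loc_of_deriv_le (s := Set.Icc (r - 1) (r + 1))
    (F' := fun s z => H (s, z))
    (bound := (Metric.closedBall (0 : ℝ × ℝ) 1).indicator fun _ => C)
    (Icc_mem_nhds (by linarith) (by linarith)) ?_ ?_ ?_ ?_ ?_ ?_).2
  · refine Filter.Eventually.of_forall fun s => Continuous.aestronglyMeasurable ?_
    exact (continuous_comp_add_smul hv.continuous p s).mul (cb.pow 2)
  · exact integrable_mul_parabolaBump_pow (continuous_comp_add_smul hv.continuous p r) (by simp)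
  · exact (cH.comp (by fun_prop : Continuous fun z : ℝ × ℝ => (r, z))).aestronglyMeasurable
  · refine Filter.Eventually.of_forall fun z s hs => ?_
    by_cases hz : z ∈ Metric.closedBall (0 : ℝ × ℝ) 1
    · rw [Set.indicator_of_mem hz]
      exact hC (s, z) ⟨hs, hz⟩
    · have : parabolaBump z = 0 := by
        by_contra hc
        exact hz (by simpa using norm_le_one_of_parabolaBump_ne_zero hc)
      simp [hH, this, hz]
  · rw [integrable_indicator_iff measurableSet_closedBall]
    exact integrableOn_const (isCompact_closedBall _ _).measure_lt_top.ne
  · refine Filter.Eventually.of_forall fun z s _ => ?_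
    have hd : HasFDerivAt v (fderiv ℝ v (p + s • z)) (p + s • z) :=
      (hv.differentiable (by simp) _).hasFDerivAt
    have h1 : HasDerivAt (fun s : ℝ => p + s • z) z s := by
      simpa using ((hasDerivAt_id s).smul_const z).const_add p
    refine ((hd.comp_hasDerivAt s h1).mul_const (parabolaBump z ^ 2)).congr_deriv ?_
    have hz : z = z.1 • ((1 : ℝ), (0 : ℝ)) + z.2 • ((0 : ℝ), (1 : ℝ)) := by ext <;> simp
    simp only [hH, pdx_eq hv, pdy_eq hv]
    conv_lhs => rw [hz, map_add, map_smul, map_smul, ← hz]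
    simp

lemma abs_fst_mul_parabolaBump_pow_le (z : ℝ × ℝ) {n : ℕ} (hn : n ≠ 0) :
    |z.1| * parabolaBump z ^ n ≤ parabolaBump z ^ n := by
  by_cases hz : parabolaBump z = 0
  · simp [hz, hn]
  · have h1 : |z.1| ≤ 1 := (norm_fst_le z).trans (norm_le_one_of_parabolaBump_ne_zero hz)
    exact mul_le_of_le_one_left (pow_nonneg (parabolaBump_nonneg z) n) h1

lemma sq_mul_integral_comp_add_smul_sq_le {G : ℝ × ℝ → ℝ} (p : ℝ × ℝ) (r : ℝ) :
    r ^ 2 * ∫ z : ℝ × ℝ, G (p + r • z) ^ 2 ≤ ∫ z, G z ^ 2 := by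
  rcases eq_or_ne r 0 with rfl | hr
  · simpa using integral_nonneg fun z => sq_nonneg (G z)
  · have h1 := Measure.integral_comp_smul (volume : Measure (ℝ × ℝ))
      (fun z => G (p + z) ^ 2) r
    rw [h1, integral_add_left_eq_self (fun z => G z ^ 2) p]
    have : Module.finrank ℝ (ℝ × ℝ) = 2 := by simp
    rw [this, abs_of_nonneg (by positivity), smul_eq_mul, ← mul_assoc,
      mul_inv_cancel₀ (by positivity), one_mul]

lemma exists_bound_pdx {M : ℝ} (hM : 0 < M) :
    ∃ K : ℝ, 0 < K ∧ ∀ ψ G h : ℝ × ℝ → ℝ, ContDiff ℝ ∞ ψ → Continuous G → Continuous h →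
      (∀ q, |ψ q| ≤ M) → Integrable (fun q => G q ^ 2) → ∫ q, G q ^ 2 ≤ M ^ 2 →
      (∀ q, |h q| ≤ M) →
      (∀ q, pdx (pdx (pdx ψ)) q + pdx (pdy (pdy ψ)) q + (1 / 2) * pdx (fun q => ψ q ^ 2) q
        = G q + h q) →
      ∀ p, |pdx ψ p| ≤ K := by
  set I : ℕ → ℝ := fun n => ∫ z, parabolaBump z ^ n with hI
  have hI0 : ∀ n, 0 ≤ I n := fun n =>
    integral_nonneg fun z => pow_nonneg (parabolaBump_nonneg z) n
  have hI2 : 0 < I 2 := integral_parabolaBump_sq_pos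
  set D : ℝ := (1 / 2 * (M ^ 2 + I 6) + M * I 3 + 3 * M ^ 2 * I 2) / 6 with hD
  refine ⟨(4 * M * I 1 + D) / I 2, ?_, ?_⟩
  · have := hI0 1
    have := hI0 3
    have := hI0 6
    positivity
  intro ψ G h hψ hG hh hψM hGi hGM hhM heq p
  have hv := contDiff_pdx hψ
  have hvx := contDiff_pdx hv
  have hvy := contDiff_pdy hv
  have hψ2 : ContDiff ℝ ∞ fun q => ψ q ^ 2 := hψ.pow 2
  have hcomm : pdx (pdy (pdy ψ)) = pdy (pdy (pdx ψ)) := by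
    rw [pdx_pdy_comm (contDiff_pdy hψ), pdx_pdy_comm hψ]
  set m : ℝ → ℝ := fun r => ∫ z : ℝ × ℝ, pdx ψ (p + r • z) * parabolaBump z ^ 2 with hm
  set m' : ℝ → ℝ := fun r => ∫ z : ℝ × ℝ,
    (z.1 * pdx (pdx ψ) (p + r • z) + z.2 * pdy (pdx ψ) (p + r • z)) * parabolaBump z ^ 2 with hm'
  have hderiv : ∀ r, HasDerivAt m (m' r) r := fun r => hasDerivAt_integral_comp_add_smul hv p r
  have hm0 : m 0 = pdx ψ p * I 2 := by simp [hm, hI, integral_const_mul]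
  have hm1 : |m 1| ≤ 4 * M * I 1 := by
    have h1 := integral_pdx_mul_parabolaBump hψ p 1 0
    have h2 : m 1 = ∫ z : ℝ × ℝ, 2 * (((0 : ℕ) : ℝ) + 2) * (z.1 * ψ (p + (1 : ℝ) • z))
        * parabolaBump z ^ (0 + 1) := by
      rw [← h1]; simp [hm]
    rw [h2, hI, ← integral_const_mul]
    refine abs_integral_le_of_abs_le ((integrable_parabolaBump_pow one_ne_zero).const_mul _)
      (fun z => ?_)
    have hb := parabolaBump_nonneg z
    have h3 := abs_fst_mul_parabolaBump_pow_le z one_ne_zero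
    rw [abs_mul, abs_mul, abs_mul, abs_of_nonneg (pow_nonneg hb _)]
    norm_num at h3 ⊢
    nlinarith [mul_le_mul h3 (hψM (p + z)) (abs_nonneg _) hb]
  have hm'1 : ∀ r ∈ Set.Ico (0 : ℝ) 1, ‖m' r‖ ≤ D := by
    intro r hr
    have hb3 : ∀ {F : ℝ × ℝ → ℝ}, Continuous F →
        Integrable fun z => r * F (p + r • z) * parabolaBump z ^ 3 := fun hF =>
      integrable_mul_parabolaBump_pow ((continuous_comp_add_smul hF p r).const_mul r) (by simp)
    have e1 : 6 * m' r = (∫ z : ℝ × ℝ, r * pdx (pdx (pdx ψ)) (p + r • z) * parabolaBump z ^ 3)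
        + ∫ z : ℝ × ℝ, r * pdy (pdy (pdx ψ)) (p + r • z) * parabolaBump z ^ 3 := by
      have c1 := hvx.continuous
      have c2 := hvy.continuous
      rw [integral_pdx_mul_parabolaBump hvx p r 1, integral_pdy_mul_parabolaBump hvy p r 1,
        ← integral_add, hm', ← integral_const_mul]
      · congr 1; ext z; push_cast; ring
      · exact integrable_mul_parabolaBump_pow (by fun_prop) (by simp)
      · exact integrable_mul_parabolaBump_pow (by fun_prop) (by simp)
    have e2 : 6 * m' r = (∫ z : ℝ × ℝ, r * G (p + r • z) * parabolaBump z ^ 3)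
        + (∫ z : ℝ × ℝ, r * h (p + r • z) * parabolaBump z ^ 3)
        - ∫ z : ℝ × ℝ, 3 * (z.1 * ψ (p + r • z) ^ 2) * parabolaBump z ^ 2 := by
      have e3 : ∫ z : ℝ × ℝ, 3 * (z.1 * ψ (p + r • z) ^ 2) * parabolaBump z ^ 2
          = (1 / 2) * ∫ z : ℝ × ℝ, r * pdx (fun q => ψ q ^ 2) (p + r • z)
            * parabolaBump z ^ 3 := by
        rw [integral_pdx_mul_parabolaBump hψ2 p r 1, ← integral_const_mul]
        congr 1; ext z; push_cast; ring
      rw [e1, e3, ← integral_const_mul, ← integral_add, ← integral_add, ← integral_sub]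
      · congr 1; ext z
        have := heq (p + r • z)
        rw [hcomm] at this
        linear_combination r * parabolaBump z ^ 3 * this
      · exact (hb3 hG).add (hb3 hh)
      · exact (hb3 (contDiff_pdx hψ2).continuous).const_mul _
      · exact hb3 hG
      · exact hb3 hh
      · exact hb3 (contDiff_pdx hvx).continuous
      · exact hb3 (contDiff_pdy hvy).continuous
    have b1 : |∫ z : ℝ × ℝ, r * G (p + r • z) * parabolaBump z ^ 3| ≤ 1 / 2 * (M ^ 2 + I 6) := by
      have hGi' : Integrable fun z : ℝ × ℝ => (r * G (p + r • z)) ^ 2 := by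
        rcases eq_or_ne r 0 with rfl | hr0
        · simp
        · simp only [mul_pow]
          exact ((hGi.comp_add_left p).comp_smul hr0).const_mul _
      have hle : |∫ z : ℝ × ℝ, r * G (p + r • z) * parabolaBump z ^ 3|
          ≤ ∫ z : ℝ × ℝ, 1 / 2 * ((r * G (p + r • z)) ^ 2 + parabolaBump z ^ 6) := by
        refine abs_integral_le_of_abs_le
          ((hGi'.add (integrable_parabolaBump_pow (n := 6) (by simp))).const_mul _)
          (fun z => ?_)
        rw [abs_le]
        constructor <;> nlinarith [sq_nonneg (r * G (p + r • z) - parabolaBump z ^ 3),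
          sq_nonneg (r * G (p + r • z) + parabolaBump z ^ 3)]
      refine hle.trans ?_
      rw [integral_const_mul, integral_add hGi' (integrable_parabolaBump_pow (by simp))]
      simp only [mul_pow, integral_const_mul]
      have := sq_mul_integral_comp_add_smul_sq_le (G := G) p r
      simp only [hI]
      linarith
    have b2 : |∫ z : ℝ × ℝ, r * h (p + r • z) * parabolaBump z ^ 3| ≤ M * I 3 := by
      rw [hI, ← integral_const_mul]
      refine abs_integral_le_of_abs_le ((integrable_parabolaBump_pow three_ne_zero).const_mul _)
        (fun z => ?_)
      have hb := pow_nonneg (parabolaBump_nonneg z) 3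
      rw [abs_mul, abs_mul, abs_of_nonneg hb, abs_of_nonneg hr.1]
      refine mul_le_mul_of_nonneg_right ?_ hb
      nlinarith [hhM (p + r • z), hr.1, hr.2, abs_nonneg (h (p + r • z))]
    have b3 : |∫ z : ℝ × ℝ, 3 * (z.1 * ψ (p + r • z) ^ 2) * parabolaBump z ^ 2|
        ≤ 3 * M ^ 2 * I 2 := by
      rw [hI, ← integral_const_mul]
      refine abs_integral_le_of_abs_le ((integrable_parabolaBump_pow two_ne_zero).const_mul _)
        (fun z => ?_)
      have hb := pow_nonneg (parabolaBump_nonneg z) 2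
      have h3 := abs_fst_mul_parabolaBump_pow_le z two_ne_zero
      have h4 : ψ (p + r • z) ^ 2 ≤ M ^ 2 := by
        rw [← sq_abs]; exact pow_le_pow_left₀ (abs_nonneg _) (hψM _) 2
      rw [abs_mul, abs_mul, abs_mul, abs_of_nonneg hb,
        abs_of_nonneg (sq_nonneg (ψ _)), abs_of_nonneg (by norm_num : (0 : ℝ) ≤ 3)]
      nlinarith [mul_le_mul h3 h4 (sq_nonneg _) hb]
    rw [Real.norm_eq_abs, hD, abs_le]
    rw [abs_le] at b1 b2 b3
    constructor <;> linarith
  have hmv := norm_image_sub_le_of_norm_deriv_le_segment_01'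
    (f := m) (fun r _ => (hderiv r).hasDerivWithinAt) hm'1
  rw [le_div_iff₀ hI2, ← abs_of_pos hI2, ← abs_mul, ← hm0]
  rw [Real.norm_eq_abs, abs_le] at hmv
  rw [abs_le] at hm1 ⊢
  constructor <;> linarith

/-! ### Uniform decay of Schwartz functions -/

/-- An integrable weight on the plane. -/
def decayWeight (q : ℝ × ℝ) : ℝ := (1 + ‖q‖) ^ (-3 : ℝ)

lemma decayWeight_nonneg (q : ℝ × ℝ) : 0 ≤ decayWeight q := by
  unfold decayWeight; positivity

lemma decayWeight_le_one (q : ℝ × ℝ) : decayWeight q ≤ 1 := by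
  unfold decayWeight
  exact Real.rpow_le_one_of_one_le_of_nonpos (by linarith [norm_nonneg q]) (by norm_num)

lemma integrable_decayWeight : Integrable decayWeight := by
  unfold decayWeight
  apply integrable_one_add_norm
  rw [Module.finrank_prod]
  norm_num

lemma le_mul_decayWeight {a b r : ℝ} {q : ℝ × ℝ} (h0 : |r| ≤ a) (h3 : ‖q‖ ^ 3 * |r| ≤ b) :
    |r| ≤ 4 * (a + b) * decayWeight q := by
  unfold decayWeight
  have hn := norm_nonneg q
  have hpos : 0 < (1 + ‖q‖) ^ 3 := by positivity
  have : (1 + ‖q‖) ^ (-3 : ℝ) = ((1 + ‖q‖) ^ 3)⁻¹ := by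
    rw [Real.rpow_neg (by positivity)]
    norm_cast
  rw [this, ← div_eq_mul_inv, le_div_iff₀ hpos]
  have h4 : (1 + ‖q‖) ^ 3 ≤ 4 * (1 + ‖q‖ ^ 3) := by
    nlinarith [mul_nonneg (by linarith : 0 ≤ 1 + ‖q‖) (sq_nonneg (1 - ‖q‖))]
  calc |r| * (1 + ‖q‖) ^ 3 ≤ |r| * (4 * (1 + ‖q‖ ^ 3)) := by gcongr
    _ ≤ 4 * (a + b) := by nlinarith

lemma SchwartzMap.abs_le_decayWeight (f : SchwartzMap (ℝ × ℝ) ℝ) (q : ℝ × ℝ) :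
    |f q| ≤ 4 * (SchwartzMap.seminorm ℝ 0 0 f + SchwartzMap.seminorm ℝ 3 0 f) * decayWeight q := by
  apply le_mul_decayWeight
  · simpa [Real.norm_eq_abs] using SchwartzMap.norm_le_seminorm ℝ f q
  · simpa [Real.norm_eq_abs] using SchwartzMap.norm_pow_mul_le_seminorm ℝ f 3 q

lemma exists_uniform_decay {v : ℝ → SchwartzMap (ℝ × ℝ) ℝ} {s : Set ℝ} (hs : IsCompact s)
    (hv : ContinuousOn v s) :
    ∃ K : ℝ, 0 ≤ K ∧ ∀ t ∈ s, ∀ q, |v t q| ≤ K * decayWeight q := by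
  have hc (k : ℕ) : ContinuousOn (fun t => SchwartzMap.seminorm ℝ k 0 (v t)) s :=
    ((schwartz_withSeminorms ℝ (ℝ × ℝ) ℝ).continuous_seminorm (k, 0)).comp_continuousOn hv
  obtain ⟨K, hK⟩ := hs.exists_bound_of_continuousOn ((hc 0).add (hc 3))
  refine ⟨4 * |K|, by positivity, fun t ht q => ((v t).abs_le_decayWeight q).trans ?_⟩
  have h := (le_abs_self _).trans ((hK t ht).trans (le_abs_self K))
  have := decayWeight_nonneg q
  gcongr
  exact h

/-! ### The Ladyzhenskaya inequality for Schwartz functions -/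

/-- The first partial derivative as an operator on Schwartz functions. -/
def schwartzDx : SchwartzMap (ℝ × ℝ) ℝ →L[ℝ] SchwartzMap (ℝ × ℝ) ℝ :=
  LineDeriv.lineDerivOpCLM ℝ (SchwartzMap (ℝ × ℝ) ℝ) ((1, 0) : ℝ × ℝ)

/-- The second partial derivative as an operator on Schwartz functions. -/
def schwartzDy : SchwartzMap (ℝ × ℝ) ℝ →L[ℝ] SchwartzMap (ℝ × ℝ) ℝ :=
  LineDeriv.lineDerivOpCLM ℝ (SchwartzMap (ℝ × ℝ) ℝ) ((0, 1) : ℝ × ℝ)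

lemma SchwartzMap.pdx_eq (f : SchwartzMap (ℝ × ℝ) ℝ) : pdx f = schwartzDx f := by
  rw [_root_.pdx_eq (f.smooth ⊤)]; rfl

lemma SchwartzMap.pdy_eq (f : SchwartzMap (ℝ × ℝ) ℝ) : pdy f = schwartzDy f := by
  rw [_root_.pdy_eq (f.smooth ⊤)]; rfl

lemma norm_sq_slice_le {g g' : ℝ → ℝ} (hd : ∀ s, HasDerivAt g (g' s) s)
    (hlim : Filter.Tendsto g Filter.atBot (nhds 0))
    (hi : Integrable fun s => g s * g' s) (x : ℝ) : g x ^ 2 ≤ 2 * ∫ s, |g s * g' s| := by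
  have h := integral_Iic_of_hasDerivAt_of_tendsto' (a := x) (f := fun s => g s ^ 2)
    (f' := fun s => 2 * (g s * g' s)) (m := 0)
    (fun s _ => ((hd s).pow 2).congr_deriv (by simp; ring))
    (hi.const_mul 2).integrableOn (by simpa using hlim.pow 2)
  have h2 : g x ^ 2 = ∫ s in Set.Iic x, 2 * (g s * g' s) := by linarith
  rw [h2, ← integral_const_mul]
  calc ∫ s in Set.Iic x, 2 * (g s * g' s) ≤ ∫ s in Set.Iic x, 2 * |g s * g' s| :=
        integral_mono (hi.const_mul 2).integrableOn (hi.abs.const_mul 2).integrableOn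
          fun s => by have := le_abs_self (g s * g' s); simp only; linarith
    _ ≤ ∫ s, 2 * |g s * g' s| :=
        setIntegral_le_integral (hi.abs.const_mul 2) (Filter.Eventually.of_forall fun s => by
          simp only [Pi.zero_apply]; positivity)

lemma SchwartzMap.tendsto_slice (f : SchwartzMap (ℝ × ℝ) ℝ) {c : ℝ → ℝ × ℝ}
    (hc : ∀ s, |s| ≤ ‖c s‖) : Filter.Tendsto (fun s => f (c s)) Filter.atBot (nhds 0) := by
  have h1 : Filter.Tendsto c Filter.atBot (Filter.cocompact (ℝ × ℝ)) := by
    rw [← Metric.cobounded_eq_cocompact, ← tendsto_norm_atTop_iff_cobounded]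
    exact Filter.tendsto_atTop_mono hc Filter.tendsto_abs_atBot_atTop
  exact (zero_at_infty f.toZeroAtInfty).comp h1

lemma SchwartzMap.integrable_slice_mul (f g : SchwartzMap (ℝ × ℝ) ℝ) {c : ℝ → ℝ × ℝ}
    (hcc : Continuous c) (hc : ∀ s, |s| ≤ ‖c s‖) : Integrable fun s => f (c s) * g (c s) := by
  have hw : Integrable fun s : ℝ => (1 + ‖s‖) ^ (-3 : ℝ) := by
    apply integrable_one_add_norm; norm_num
  set a := 4 * (SchwartzMap.seminorm ℝ 0 0 f + SchwartzMap.seminorm ℝ 3 0 f)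
  set b := 4 * (SchwartzMap.seminorm ℝ 0 0 g + SchwartzMap.seminorm ℝ 3 0 g)
  have ha : 0 ≤ a := by positivity
  have hb : 0 ≤ b := by positivity
  refine (hw.const_mul (a * b)).mono' (by fun_prop) (Filter.Eventually.of_forall fun s => ?_)
  have h1 := f.abs_le_decayWeight (c s)
  have h2 := g.abs_le_decayWeight (c s)
  have hle : decayWeight (c s) ≤ (1 + ‖s‖) ^ (-3 : ℝ) := by
    unfold decayWeight
    apply Real.rpow_le_rpow_of_nonpos (by positivity) (by simpa [Real.norm_eq_abs] using hc s)
      (by norm_num)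
  have h0 := decayWeight_nonneg (c s)
  have h3 := decayWeight_le_one (c s)
  rw [Real.norm_eq_abs, abs_mul]
  calc |f (c s)| * |g (c s)| ≤ (a * decayWeight (c s)) * (b * decayWeight (c s)) := by
        gcongr
    _ = a * b * (decayWeight (c s) * decayWeight (c s)) := by ring
    _ ≤ a * b * (1 * (1 + ‖s‖) ^ (-3 : ℝ)) := by gcongr
    _ = _ := by ring

lemma SchwartzMap.integrable_mul (f g : SchwartzMap (ℝ × ℝ) ℝ) :
    Integrable fun q => f q * g q :=
  (f.memLp 2 volume).integrable_mul (g.memLp 2 volume)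

/-- The Ladyzhenskaya inequality `‖f‖₄⁴ ≤ 2 ‖f‖₂² ‖∇f‖₂²` on the plane. -/
theorem SchwartzMap.ladyzhenskaya (f : SchwartzMap (ℝ × ℝ) ℝ) :
    ∫ q, f q ^ 4 ≤ 2 * (∫ q, f q ^ 2) * ((∫ q, pdx f q ^ 2) + ∫ q, pdy f q ^ 2) := by
  rw [f.pdx_eq, f.pdy_eq]
  set fx := schwartzDx f with hfx
  set fy := schwartzDy f with hfy
  have hX (x y : ℝ) : f (x, y) ^ 2 ≤ 2 * ∫ s, |f (s, y) * fx (s, y)| :=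
    norm_sq_slice_le (g := fun s => f (s, y)) (fun s => by
      have := hasDerivAt_pdx (f.smooth ⊤) (s, y); rwa [f.pdx_eq] at this)
      (f.tendsto_slice fun s => by rw [← Real.norm_eq_abs]; exact norm_fst_le (s, y))
      (f.integrable_slice_mul fx (by fun_prop)
        fun s => by rw [← Real.norm_eq_abs]; exact norm_fst_le (s, y)) x
  have hY (x y : ℝ) : f (x, y) ^ 2 ≤ 2 * ∫ s, |f (x, s) * fy (x, s)| :=
    norm_sq_slice_le (g := fun s => f (x, s)) (fun s => by
      have := hasDerivAt_pdy (f.smooth ⊤) (x, s); rwa [f.pdy_eq] at this)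
      (f.tendsto_slice fun s => by rw [← Real.norm_eq_abs]; exact norm_snd_le (x, s))
      (f.integrable_slice_mul fy (by fun_prop)
        fun s => by rw [← Real.norm_eq_abs]; exact norm_snd_le (x, s)) y
  have ix : Integrable fun q => |f q * fx q| := (f.integrable_mul fx).abs
  have iy : Integrable fun q => |f q * fy q| := (f.integrable_mul fy).abs
  rw [Measure.volume_eq_prod] at ix iy
  have jx : Integrable fun y => ∫ s, |f (s, y) * fx (s, y)| := ix.integral_prod_right
  have jy : Integrable fun x => ∫ s, |f (x, s) * fy (x, s)| := iy.integral_prod_left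
  have hprod := jy.mul_prod jx
  have eX : ∫ y, ∫ s, |f (s, y) * fx (s, y)| = ∫ q, |f q * fx q| := by
    rw [Measure.volume_eq_prod, integral_prod_symm _ ix]
  have eY : ∫ x, ∫ s, |f (x, s) * fy (x, s)| = ∫ q, |f q * fy q| := by
    rw [Measure.volume_eq_prod, integral_prod _ iy]
  have hI : ∫ q, f q ^ 4 ≤ 4 * ((∫ q, |f q * fy q|) * ∫ q, |f q * fx q|) := by
    rw [← eX, ← eY, ← integral_prod_mul, ← integral_const_mul, ← Measure.volume_eq_prod]
    rw [← Measure.volume_eq_prod] at hprod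
    refine integral_mono_of_nonneg (Filter.Eventually.of_forall fun q => by
      simp only [Pi.zero_apply]; positivity) (hprod.const_mul 4)
      (Filter.Eventually.of_forall fun q => ?_)
    have h1 := hX q.1 q.2
    have h2 := hY q.1 q.2
    simp only [Prod.mk.eta] at h1 h2 ⊢
    have := sq_nonneg (f q)
    nlinarith [mul_le_mul h1 h2 this (this.trans h1)]
  have cs (g : SchwartzMap (ℝ × ℝ) ℝ) :
      (∫ q, |f q * g q|) ^ 2 ≤ (∫ q, f q ^ 2) * ∫ q, g q ^ 2 := by
    have := sq_integral_mul_le (f.memLp 2 volume).abs (g.memLp 2 volume).abs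
    simpa [abs_mul] using this
  nlinarith [cs fx, cs fy, sq_nonneg ((∫ q, |f q * fy q|) - ∫ q, |f q * fx q|)]

/-! ### Differentiation in time under the integral -/

/-- Evaluation at a point as a continuous functional on Schwartz functions. -/
def schwartzEval (q : ℝ × ℝ) : SchwartzMap (ℝ × ℝ) ℝ →L[ℝ] ℝ :=
  (BoundedContinuousFunction.evalCLM ℝ q).comp
    (SchwartzMap.toBoundedContinuousFunctionCLM ℝ (ℝ × ℝ) ℝ)

section TimeRegularity

variable {T : ℝ} {u u' : ℝ → SchwartzMap (ℝ × ℝ) ℝ}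

lemma continuousOn_of_tendsto_slope
    (hdu : ∀ t ∈ Set.Icc (0 : ℝ) T, Filter.Tendsto (fun s => (s - t)⁻¹ • (u s - u t))
      (nhdsWithin t (Set.Icc (0 : ℝ) T \ {t})) (nhds (u' t))) :
    ContinuousOn u (Set.Icc 0 T) := by
  intro t ht
  rw [← continuousWithinAt_sdiff_self]
  have h1 : Filter.Tendsto (fun s : ℝ => s - t) (nhdsWithin t (Set.Icc (0 : ℝ) T \ {t}))
      (nhds 0) := by
    have : Filter.Tendsto (fun s : ℝ => s - t) (nhds t) (nhds (t - t)) :=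
      (continuous_id.sub continuous_const).tendsto t
    rw [sub_self] at this
    exact this.mono_left nhdsWithin_le_nhds
  have h2 := (h1.smul (hdu t ht)).const_add (u t)
  rw [zero_smul, add_zero] at h2
  refine h2.congr' ?_
  filter_upwards [self_mem_nhdsWithin] with s hs
  rw [smul_smul, mul_inv_cancel₀ (sub_ne_zero.2 hs.2), one_smul, add_sub_cancel]

lemma hasDerivAt_clm_of_tendsto_slope
    (hdu : ∀ t ∈ Set.Icc (0 : ℝ) T, Filter.Tendsto (fun s => (s - t)⁻¹ • (u s - u t))
      (nhdsWithin t (Set.Icc (0 : ℝ) T \ {t})) (nhds (u' t)))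
    (L : SchwartzMap (ℝ × ℝ) ℝ →L[ℝ] ℝ) {t : ℝ} (ht : t ∈ Set.Ioo 0 T) :
    HasDerivAt (fun s => L (u s)) (L (u' t)) t := by
  rw [hasDerivAt_iff_tendsto_slope]
  have h := (L.continuous.tendsto _).comp (hdu t (Set.Ioo_subset_Icc_self ht))
  have hn : nhdsWithin t (Set.Icc (0 : ℝ) T \ {t}) = nhdsWithin t {t}ᶜ := by
    rw [Set.sdiff_eq, Set.inter_comm]
    exact nhdsWithin_inter_of_mem' (mem_nhdsWithin_of_mem_nhds (Icc_mem_nhds ht.1 ht.2))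
  rw [hn] at h
  refine h.congr fun s => ?_
  simp [slope_def_field, div_eq_inv_mul]

variable {F F' : ℝ → ℝ × ℝ → ℝ} {K : ℝ}

lemma continuousOn_integral_of_decay (hF : ∀ t, Continuous (F t))
    (hb : ∀ t ∈ Set.Icc 0 T, ∀ q, |F t q| ≤ K * decayWeight q)
    (hc : ∀ q, ContinuousOn (fun t => F t q) (Set.Icc 0 T)) :
    ContinuousOn (fun t => ∫ q, F t q) (Set.Icc 0 T) :=
  continuousOn_of_dominated (fun t _ => (hF t).aestronglyMeasurable)
    (fun t ht => Filter.Eventually.of_forall fun q => hb t ht q)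
    (integrable_decayWeight.const_mul K) (Filter.Eventually.of_forall hc)

lemma hasDerivAt_integral_of_decay (hF : ∀ t, Continuous (F t)) (hF' : ∀ t, Continuous (F' t))
    (hb : ∀ t ∈ Set.Icc 0 T, ∀ q, |F t q| ≤ K * decayWeight q)
    (hb' : ∀ t ∈ Set.Icc 0 T, ∀ q, |F' t q| ≤ K * decayWeight q)
    (hd : ∀ t ∈ Set.Ioo 0 T, ∀ q, HasDerivAt (fun s => F s q) (F' t q) t)
    {t : ℝ} (ht : t ∈ Set.Ioo 0 T) :
    HasDerivAt (fun t => ∫ q, F t q) (∫ q, F' t q) t :=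
  (hasDerivAt_integral_of_dominated_loc_of_deriv_le (Ioo_mem_nhds ht.1 ht.2)
    (Filter.Eventually.of_forall fun t => (hF t).aestronglyMeasurable)
    ((integrable_decayWeight.const_mul K).mono' (hF t).aestronglyMeasurable
      (Filter.Eventually.of_forall fun q => hb t (Set.Ioo_subset_Icc_self ht) q))
    (hF' t).aestronglyMeasurable
    (Filter.Eventually.of_forall fun q s hs => hb' s (Set.Ioo_subset_Icc_self hs) q)
    (integrable_decayWeight.const_mul K)
    (Filter.Eventually.of_forall fun q s hs => hd s hs q)).2

/-- The density of the modified energy. -/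
def energyDensity (v : SchwartzMap (ℝ × ℝ) ℝ) (ψ : ℝ × ℝ → ℝ) (q : ℝ × ℝ) : ℝ :=
  schwartzDx v q ^ 2 + schwartzDy v q ^ 2 - (1 / 3) * (v q ^ 2 * (v q + 3 * ψ q))

/-- The time derivative of the density of the modified energy, when `v` and `ψ` move with
velocities `w` and `χ`. -/
def energyDensityDeriv (v w : SchwartzMap (ℝ × ℝ) ℝ) (ψ χ : ℝ × ℝ → ℝ) (q : ℝ × ℝ) : ℝ :=
  2 * (schwartzDx v q * schwartzDx w q) + 2 * (schwartzDy v q * schwartzDy w q)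
    - v q ^ 2 * w q - 2 * (v q * w q * ψ q) - v q ^ 2 * χ q

lemma abs_mul_le_decay {a b A B w : ℝ} (ha : |a| ≤ A * w) (hb : |b| ≤ B) :
    |a * b| ≤ A * B * w := by
  rw [abs_mul]
  nlinarith [mul_le_mul ha hb (abs_nonneg b) ((abs_nonneg a).trans ha)]

lemma abs_energyDensity_le {v : SchwartzMap (ℝ × ℝ) ℝ} {ψ : ℝ × ℝ → ℝ} {q : ℝ × ℝ} {K M : ℝ}
    (hK : 0 ≤ K) (hv : |v q| ≤ K * decayWeight q)
    (hx : |schwartzDx v q| ≤ K * decayWeight q) (hy : |schwartzDy v q| ≤ K * decayWeight q)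
    (hψ : |ψ q| ≤ M) :
    |energyDensity v ψ q| ≤ (2 * K ^ 2 + K ^ 2 * K + K ^ 2 * M) * decayWeight q := by
  have hle {r : ℝ} (h : |r| ≤ K * decayWeight q) : |r| ≤ K :=
    h.trans (mul_le_of_le_one_right hK (decayWeight_le_one q))
  have e1 := abs_mul_le_decay hx (hle hx)
  have e2 := abs_mul_le_decay hy (hle hy)
  have e3 := abs_mul_le_decay hv (hle hv)
  have e4 := abs_mul_le_decay e3 (hle hv)
  have e5 := abs_mul_le_decay e3 hψ
  have e0 := (abs_nonneg _).trans e4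
  unfold energyDensity
  rw [abs_le] at *
  constructor <;> nlinarith

lemma abs_energyDensityDeriv_le {v w : SchwartzMap (ℝ × ℝ) ℝ} {ψ χ : ℝ × ℝ → ℝ} {q : ℝ × ℝ}
    {K M : ℝ} (hK : 0 ≤ K) (hv : |v q| ≤ K * decayWeight q)
    (hx : |schwartzDx v q| ≤ K * decayWeight q) (hy : |schwartzDy v q| ≤ K * decayWeight q)
    (hw : |w q| ≤ K * decayWeight q)
    (hwx : |schwartzDx w q| ≤ K * decayWeight q) (hwy : |schwartzDy w q| ≤ K * decayWeight q)
    (hψ : |ψ q| ≤ M) (hχ : |χ q| ≤ M) :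
    |energyDensityDeriv v w ψ χ q| ≤ (4 * K ^ 2 + K ^ 2 * K + 3 * K ^ 2 * M) * decayWeight q := by
  have hle {r : ℝ} (h : |r| ≤ K * decayWeight q) : |r| ≤ K :=
    h.trans (mul_le_of_le_one_right hK (decayWeight_le_one q))
  have e1 := abs_mul_le_decay hx (hle hwx)
  have e2 := abs_mul_le_decay hy (hle hwy)
  have e3 := abs_mul_le_decay hv (hle hv)
  have e4 := abs_mul_le_decay e3 (hle hw)
  have e5 := abs_mul_le_decay e3 hχ
  have e6 := abs_mul_le_decay (abs_mul_le_decay hv (hle hw)) hψ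
  unfold energyDensityDeriv
  rw [abs_le] at *
  constructor <;> nlinarith

variable {Ψ : ℝ × (ℝ × ℝ) → ℝ} {M : ℝ}

lemma contDiff_deriv_time (hΨ : ContDiff ℝ ∞ Ψ) (t : ℝ) :
    ContDiff ℝ ∞ fun q => deriv (fun s => Ψ (s, q)) t := by
  have h (q : ℝ × ℝ) : deriv (fun s => Ψ (s, q)) t = fderiv ℝ Ψ (t, q) (1, 0) := by
    have h1 : HasDerivAt (fun s : ℝ => ((s, q) : ℝ × (ℝ × ℝ))) (1, 0) t :=
      (hasDerivAt_id t).prodMk (hasDerivAt_const t q)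
    exact (((hΨ.differentiable (by simp)) (t, q)).hasFDerivAt.comp_hasDerivAt t h1).deriv
  simp_rw [h]
  have h2 : ContDiff ℝ ∞ (fderiv ℝ Ψ) := hΨ.fderiv_right (by simp)
  exact (h2.comp (contDiff_const.prodMk contDiff_id)).clm_apply contDiff_const

/-- The mass and the modified energy are continuous on `[0, T]` and differentiable inside. -/
theorem mass_energy_regularity
    (hdu : ∀ t ∈ Set.Icc (0 : ℝ) T, Filter.Tendsto (fun s => (s - t)⁻¹ • (u s - u t))
      (nhdsWithin t (Set.Icc (0 : ℝ) T \ {t})) (nhds (u' t)))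
    (hu' : ContinuousOn u' (Set.Icc 0 T)) (hΨ : ContDiff ℝ ∞ Ψ) (hM : 0 ≤ M)
    (hΨM : ∀ z, |Ψ z| ≤ M)
    (hΨt : ∀ z : ℝ × (ℝ × ℝ), |deriv (fun s => Ψ (s, z.2)) z.1| ≤ M) :
    (ContinuousOn (fun t => ∫ q, u t q ^ 2) (Set.Icc 0 T) ∧
      ∀ t ∈ Set.Ioo 0 T, HasDerivAt (fun t => ∫ q, u t q ^ 2) (∫ q, 2 * (u t q * u' t q)) t) ∧
    (ContinuousOn (fun t => ∫ q, energyDensity (u t) (fun q => Ψ (t, q)) q) (Set.Icc 0 T) ∧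
      ∀ t ∈ Set.Ioo 0 T, HasDerivAt (fun t => ∫ q, energyDensity (u t) (fun q => Ψ (t, q)) q)
        (∫ q, energyDensityDeriv (u t) (u' t) (fun q => Ψ (t, q))
          (fun q => deriv (fun s => Ψ (s, q)) t) q) t) := by
  have hu := continuousOn_of_tendsto_slope hdu
  have hI : IsCompact (Set.Icc (0 : ℝ) T) := isCompact_Icc
  obtain ⟨K1, h1, b1⟩ := exists_uniform_decay hI hu
  obtain ⟨K2, h2, b2⟩ := exists_uniform_decay hI (schwartzDx.continuous.comp_continuousOn hu)
  obtain ⟨K3, h3, b3⟩ := exists_uniform_decay hI (schwartzDy.continuous.comp_continuousOn hu)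
  obtain ⟨K4, h4, b4⟩ := exists_uniform_decay hI hu'
  obtain ⟨K5, h5, b5⟩ := exists_uniform_decay hI (schwartzDx.continuous.comp_continuousOn hu')
  obtain ⟨K6, h6, b6⟩ := exists_uniform_decay hI (schwartzDy.continuous.comp_continuousOn hu')
  simp only [Function.comp_apply] at b2 b3 b5 b6
  set K := K1 + K2 + K3 + K4 + K5 + K6 with hKdef
  have hK : 0 ≤ K := by positivity
  have up {r k : ℝ} {q : ℝ × ℝ} (h : |r| ≤ k * decayWeight q) (hk : k ≤ K) :
      |r| ≤ K * decayWeight q :=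
    h.trans (mul_le_mul_of_nonneg_right hk (decayWeight_nonneg q))
  have hle {r : ℝ} {q : ℝ × ℝ} (h : |r| ≤ K * decayWeight q) : |r| ≤ K :=
    h.trans (mul_le_of_le_one_right hK (decayWeight_le_one q))
  replace b1 := fun t ht q => up (b1 t ht q) (by linarith)
  replace b2 := fun t ht q => up (b2 t ht q) (by linarith)
  replace b3 := fun t ht q => up (b3 t ht q) (by linarith)
  replace b4 := fun t ht q => up (b4 t ht q) (by linarith)
  replace b5 := fun t ht q => up (b5 t ht q) (by linarith)
  replace b6 := fun t ht q => up (b6 t ht q) (by linarith)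
  have hc (q : ℝ × ℝ) : ContinuousOn (fun t => u t q) (Set.Icc 0 T) :=
    (schwartzEval q).continuous.comp_continuousOn hu
  have hcx (q : ℝ × ℝ) : ContinuousOn (fun t => schwartzDx (u t) q) (Set.Icc 0 T) :=
    ((schwartzEval q).comp schwartzDx).continuous.comp_continuousOn hu
  have hcy (q : ℝ × ℝ) : ContinuousOn (fun t => schwartzDy (u t) q) (Set.Icc 0 T) :=
    ((schwartzEval q).comp schwartzDy).continuous.comp_continuousOn hu
  have hcΨ (q : ℝ × ℝ) : Continuous (fun t => Ψ (t, q)) := by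
    have := hΨ.continuous; fun_prop
  have hd (t : ℝ) (ht : t ∈ Set.Ioo 0 T) (q : ℝ × ℝ) :
      HasDerivAt (fun t => u t q) (u' t q) t :=
    hasDerivAt_clm_of_tendsto_slope hdu (schwartzEval q) ht
  have hdx (t : ℝ) (ht : t ∈ Set.Ioo 0 T) (q : ℝ × ℝ) :
      HasDerivAt (fun t => schwartzDx (u t) q) (schwartzDx (u' t) q) t :=
    hasDerivAt_clm_of_tendsto_slope hdu ((schwartzEval q).comp schwartzDx) ht
  have hdy (t : ℝ) (ht : t ∈ Set.Ioo 0 T) (q : ℝ × ℝ) :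
      HasDerivAt (fun t => schwartzDy (u t) q) (schwartzDy (u' t) q) t :=
    hasDerivAt_clm_of_tendsto_slope hdu ((schwartzEval q).comp schwartzDy) ht
  have hdΨ (t : ℝ) (q : ℝ × ℝ) :
      HasDerivAt (fun t => Ψ (t, q)) (deriv (fun s => Ψ (s, q)) t) t := by
    have : DifferentiableAt ℝ (fun s => Ψ (s, q)) t :=
      ((hΨ.differentiable (by simp)) (t, q)).comp t (by fun_prop)
    exact this.hasDerivAt
  have hΨt' (t : ℝ) : Continuous fun q => deriv (fun s => Ψ (s, q)) t :=
    (contDiff_deriv_time hΨ t).continuous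
  have hΨc (t : ℝ) : Continuous fun q => Ψ (t, q) := by
    have := hΨ.continuous; fun_prop
  have m1 (t : ℝ) : Continuous fun q => u t q ^ 2 := by fun_prop
  have mb (t : ℝ) (ht : t ∈ Set.Icc 0 T) (q : ℝ × ℝ) :
      |u t q ^ 2| ≤ 2 * (K * K) * decayWeight q := by
    have := abs_mul_le_decay (b1 t ht q) (hle (b1 t ht q))
    have h0 := (abs_nonneg _).trans this
    rw [pow_two]; linarith
  have mb' (t : ℝ) (ht : t ∈ Set.Icc 0 T) (q : ℝ × ℝ) :
      |2 * (u t q * u' t q)| ≤ 2 * (K * K) * decayWeight q := by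
    have := abs_mul_le_decay (b1 t ht q) (hle (b4 t ht q))
    rw [abs_mul, abs_two]; linarith
  set L := 4 * K ^ 2 + K ^ 2 * K + 3 * K ^ 2 * M
  have eb (t : ℝ) (ht : t ∈ Set.Icc 0 T) (q : ℝ × ℝ) :
      |energyDensity (u t) (fun q => Ψ (t, q)) q| ≤ L * decayWeight q := by
    refine (abs_energyDensity_le hK (b1 t ht q) (b2 t ht q) (b3 t ht q) (hΨM (t, q))).trans
      (mul_le_mul_of_nonneg_right ?_ (decayWeight_nonneg q))
    simp only [L]
    have := mul_nonneg (sq_nonneg K) hM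
    nlinarith [sq_nonneg K]
  have eb' (t : ℝ) (ht : t ∈ Set.Icc 0 T) (q : ℝ × ℝ) :
      |energyDensityDeriv (u t) (u' t) (fun q => Ψ (t, q))
          (fun q => deriv (fun s => Ψ (s, q)) t) q| ≤ L * decayWeight q :=
    abs_energyDensityDeriv_le hK (b1 t ht q) (b2 t ht q) (b3 t ht q) (b4 t ht q) (b5 t ht q)
      (b6 t ht q) (hΨM (t, q)) (hΨt (t, q))
  have ec (t : ℝ) : Continuous (energyDensity (u t) (fun q => Ψ (t, q))) := by
    have := hΨc t
    unfold energyDensity; fun_prop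
  have ec' (t : ℝ) : Continuous (energyDensityDeriv (u t) (u' t) (fun q => Ψ (t, q))
          (fun q => deriv (fun s => Ψ (s, q)) t)) := by
    have := hΨc t
    have := hΨt' t
    unfold energyDensityDeriv; fun_prop
  refine ⟨⟨continuousOn_integral_of_decay m1 mb fun q => (hc q).pow 2, fun t ht =>
    hasDerivAt_integral_of_decay m1 (fun t => by fun_prop) mb mb' (fun t ht q => ?_) ht⟩,
    continuousOn_integral_of_decay ec eb fun q => ?_, fun t ht =>
    hasDerivAt_integral_of_decay ec ec' eb eb' (fun t ht q => ?_) ht⟩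
  · exact ((hd t ht q).pow 2).congr_deriv (by simp; ring)
  · unfold energyDensity
    exact (((hcx q).pow 2).add ((hcy q).pow 2)).sub (continuousOn_const.mul
      (((hc q).pow 2).mul ((hc q).add (continuousOn_const.mul (hcΨ q).continuousOn))))
  · unfold energyDensity energyDensityDeriv
    refine ((((hdx t ht q).pow 2).add ((hdy t ht q).pow 2)).sub
      ((((hd t ht q).pow 2).mul ((hd t ht q).add
        ((hdΨ t q).const_mul 3))).const_mul (1 / 3))).congr_deriv ?_
    simp
    ring

end TimeRegularity

/-! ### The mass and energy identities at a fixed time -/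

lemma MeasureTheory.MemLp.bounded_mul {f b : ℝ × ℝ → ℝ} {B : ℝ} (hf : MemLp f 2 volume)
    (hb : Continuous b) (hB : ∀ q, |b q| ≤ B) : MemLp (fun q => b q * f q) 2 volume :=
  MemLp.of_le_mul (c := B) hf (hb.aestronglyMeasurable.mul hf.1)
    (Filter.Eventually.of_forall fun q => by
      rw [norm_mul]; exact mul_le_mul_of_nonneg_right (hB q) (norm_nonneg _))

lemma SchwartzMap.hasDerivAt_fst (f : SchwartzMap (ℝ × ℝ) ℝ) (p : ℝ × ℝ) :
    HasDerivAt (fun x => f (x, p.2)) (schwartzDx f p) p.1 := by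
  rw [← f.pdx_eq]; exact hasDerivAt_pdx (f.smooth ⊤) p

lemma SchwartzMap.hasDerivAt_snd (f : SchwartzMap (ℝ × ℝ) ℝ) (p : ℝ × ℝ) :
    HasDerivAt (fun y => f (p.1, y)) (schwartzDy f p) p.2 := by
  rw [← f.pdy_eq]; exact hasDerivAt_pdy (f.smooth ⊤) p

lemma schwartzDx_schwartzDy (f : SchwartzMap (ℝ × ℝ) ℝ) :
    schwartzDx (schwartzDy f) = schwartzDy (schwartzDx f) := by
  apply DFunLike.coe_injective
  rw [← SchwartzMap.pdx_eq, ← SchwartzMap.pdy_eq, ← SchwartzMap.pdy_eq, ← SchwartzMap.pdx_eq]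
  exact pdx_pdy_comm (f.smooth ⊤)

lemma SchwartzMap.abs_le (f : SchwartzMap (ℝ × ℝ) ℝ) (q : ℝ × ℝ) :
    |f q| ≤ SchwartzMap.seminorm ℝ 0 0 f := by
  simpa [Real.norm_eq_abs] using SchwartzMap.norm_le_seminorm ℝ f q

lemma integral_eq_of_eq_add_null {f r h k : ℝ × ℝ → ℝ} {c d : ℝ} (hr : Integrable r)
    (hh : Integrable h) (hk : Integrable k) (h0 : ∫ q, h q = 0) (k0 : ∫ q, k q = 0)
    (split : ∀ q, f q = r q + (c * h q + d * k q)) : ∫ q, f q = ∫ q, r q := by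
  have hck : Integrable fun q => c * h q + d * k q := (hh.const_mul c).add (hk.const_mul d)
  simp_rw [split]
  rw [integral_add hr hck, integral_add (hh.const_mul c) (hk.const_mul d), integral_const_mul,
    integral_const_mul, h0, k0]
  ring

section Identities

variable {v w : SchwartzMap (ℝ × ℝ) ℝ} {ψ g : ℝ × ℝ → ℝ} {M K : ℝ}

/-- The Zakharov–Kuznetsov equation on the background `ψ`, with the products expanded. -/
lemma expanded_equation (hψ : ContDiff ℝ ∞ ψ)
    (heq : ∀ q, w q + pdx (pdx (pdx v)) q + pdx (pdy (pdy v)) q +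
      (1 / 2) * pdx (fun q => v q ^ 2) q + pdx (fun q => v q * ψ q) q + g q = 0) (q : ℝ × ℝ) :
    w q + schwartzDx (schwartzDx (schwartzDx v)) q + schwartzDx (schwartzDy (schwartzDy v)) q
      + v q * schwartzDx v q + (schwartzDx v q * ψ q + v q * pdx ψ q) + g q = 0 := by
  have h := heq q
  have h1 : pdx (fun q => v q ^ 2) q = 2 * (v q * schwartzDx v q) :=
    (((v.hasDerivAt_fst q).pow 2).congr_deriv (by simp; ring)).deriv
  have h2 : pdx (fun q => v q * ψ q) q = schwartzDx v q * ψ q + v q * pdx ψ q :=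
    ((v.hasDerivAt_fst q).mul (hasDerivAt_pdx hψ q)).deriv
  rw [h1, h2] at h
  simp only [SchwartzMap.pdx_eq, SchwartzMap.pdy_eq] at h
  linarith

theorem mass_identity (hψ : ContDiff ℝ ∞ ψ) (hψM : ∀ q, |ψ q| ≤ M) (hψK : ∀ q, |pdx ψ q| ≤ K)
    (hg : MemLp g 2 volume)
    (heq : ∀ q, w q + pdx (pdx (pdx v)) q + pdx (pdy (pdy v)) q +
      (1 / 2) * pdx (fun q => v q ^ 2) q + pdx (fun q => v q * ψ q) q + g q = 0) :
    ∫ q, 2 * (v q * w q) = ∫ q, (-(v q * (pdx ψ q * v q)) - 2 * (v q * g q)) := by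
  have heq' := expanded_equation hψ heq
  set a := schwartzDx (schwartzDx v) with ha
  set b := schwartzDy (schwartzDx v) with hb
  set c := schwartzDy (schwartzDy v) with hc
  set vx := schwartzDx v with hvx
  set vy := schwartzDy v with hvy
  have hb' : schwartzDx vy = b := schwartzDx_schwartzDy v
  have L (f : SchwartzMap (ℝ × ℝ) ℝ) : MemLp f 2 volume := f.memLp 2 volume
  have ψc := hψ.continuous
  have ψxc := (contDiff_pdx hψ).continuous
  have vψ : MemLp (fun q => ψ q * v q) 2 volume := (L v).bounded_mul ψc hψM
  have vxψ : MemLp (fun q => ψ q * vx q) 2 volume := (L vx).bounded_mul ψc hψM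
  have vψx : MemLp (fun q => pdx ψ q * v q) 2 volume := (L v).bounded_mul ψxc hψK
  have vv : MemLp (fun q => v q * v q) 2 volume := (L v).bounded_mul v.continuous v.abs_le
  have vvx : MemLp (fun q => v q * vx q) 2 volume := (L vx).bounded_mul v.continuous v.abs_le
  have I {f h : ℝ × ℝ → ℝ} (hf : MemLp f 2 volume) (hh : MemLp h 2 volume) :
      Integrable fun q => f q * h q := hf.integrable_mul hh
  have ix : Integrable fun q => v q * (schwartzDx a q + schwartzDx c q) + v q * (v q * vx q)
      + v q * (ψ q * vx q) + (1 / 2) * (v q * (pdx ψ q * v q)) + vx q * c q + vy q * b q :=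
    (((((I (L v) ((L (schwartzDx a)).add (L (schwartzDx c)))).add (I (L v) vvx)).add
      (I (L v) vxψ)).add ((I (L v) vψx).const_mul (1 / 2))).add (I (L vx) (L c))).add
      (I (L vy) (L b))
  have iy : Integrable fun q => b q * vy q + vx q * c q :=
    (I (L b) (L vy)).add (I (L vx) (L c))
  have hx := integral_eq_zero_of_hasDerivAt_fst
    (h := fun q => v q * (a q + c q) + (1 / 3) * (v q * (v q * v q)) + (1 / 2) * (v q * (ψ q * v q))
      - (1 / 2) * (vx q * vx q) + (1 / 2) * (vy q * vy q))
    (h' := fun q => v q * (schwartzDx a q + schwartzDx c q) + v q * (v q * vx q)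
      + v q * (ψ q * vx q) + (1 / 2) * (v q * (pdx ψ q * v q)) + vx q * c q + vy q * b q)
    (fun p => by
      refine (((((v.hasDerivAt_fst p).mul ((a.hasDerivAt_fst p).add (c.hasDerivAt_fst p))).add
        (((v.hasDerivAt_fst p).mul ((v.hasDerivAt_fst p).mul (v.hasDerivAt_fst p))).const_mul
          (1 / 3))).add
        (((v.hasDerivAt_fst p).mul ((hasDerivAt_pdx hψ p).mul (v.hasDerivAt_fst p))).const_mul
          (1 / 2))).sub
        (((vx.hasDerivAt_fst p).mul (vx.hasDerivAt_fst p)).const_mul (1 / 2))).add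
        (((vy.hasDerivAt_fst p).mul (vy.hasDerivAt_fst p)).const_mul (1 / 2)) |>.congr_deriv ?_
      simp only [← hvx, hb', ← ha, Pi.mul_apply, Pi.add_apply, Prod.mk.eta]
      ring)
    (((((I (L v) ((L a).add (L c))).add ((I (L v) vv).const_mul (1 / 3))).add
      ((I (L v) vψ).const_mul (1 / 2))).sub ((I (L vx) (L vx)).const_mul (1 / 2))).add
      ((I (L vy) (L vy)).const_mul (1 / 2))) ix
  have hy := integral_eq_zero_of_hasDerivAt_snd
    (h := fun q => vx q * vy q) (h' := fun q => b q * vy q + vx q * c q)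
    (fun p => (vx.hasDerivAt_snd p).mul (vy.hasDerivAt_snd p))
    (I (L vx) (L vy)) iy
  have ir : Integrable fun q => -(v q * (pdx ψ q * v q)) - 2 * (v q * g q) :=
    (I (L v) vψx).neg.sub ((I (L v) hg).const_mul 2)
  exact integral_eq_of_eq_add_null (c := -2) (d := 2) ir ix iy hx hy fun q => by
    linear_combination 2 * v q * heq' q

theorem energy_identity {χ : ℝ × ℝ → ℝ} (hψ : ContDiff ℝ ∞ ψ) (hψM : ∀ q, |ψ q| ≤ M)
    (hχ : Continuous χ) (hχM : ∀ q, |χ q| ≤ M) (hg' : ContDiff ℝ ∞ g)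
    (hg : MemLp g 2 volume) (hgx : MemLp (pdx g) 2 volume) (hgy : MemLp (pdy g) 2 volume)
    (heq : ∀ q, w q + pdx (pdx (pdx v)) q + pdx (pdy (pdy v)) q +
      (1 / 2) * pdx (fun q => v q ^ 2) q + pdx (fun q => v q * ψ q) q + g q = 0) :
    ∫ q, energyDensityDeriv v w ψ χ q =
      ∫ q, (-2 * (schwartzDx v q * pdx g q) - 2 * (schwartzDy v q * pdy g q) +
        (v q * v q) * g q + 2 * ((ψ q * v q) * g q) - v q * (χ q * v q)) := by
  have heq' := expanded_equation hψ heq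
  set a := schwartzDx (schwartzDx v) with ha
  set c := schwartzDy (schwartzDy v) with hc
  set vx := schwartzDx v with hvx
  set vy := schwartzDy v with hvy
  have L (f : SchwartzMap (ℝ × ℝ) ℝ) : MemLp f 2 volume := f.memLp 2 volume
  have ψc := hψ.continuous
  have vψ : MemLp (fun q => ψ q * v q) 2 volume := (L v).bounded_mul ψc hψM
  have vχ : MemLp (fun q => χ q * v q) 2 volume := (L v).bounded_mul hχ hχM
  have vv : MemLp (fun q => v q * v q) 2 volume := (L v).bounded_mul v.continuous v.abs_le
  have I {f h : ℝ × ℝ → ℝ} (hf : MemLp f 2 volume) (hh : MemLp h 2 volume) :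
      Integrable fun q => f q * h q := hf.integrable_mul hh
  set W : ℝ × ℝ → ℝ := fun q => (a q + c q) + (1 / 2) * (v q * v q) + ψ q * v q with hW
  set R : ℝ × ℝ → ℝ := fun q => w q + g q with hR
  set Rx : ℝ × ℝ → ℝ := fun q => schwartzDx w q + pdx g q with hRx
  set Ry : ℝ × ℝ → ℝ := fun q => schwartzDy w q + pdy g q with hRy
  have LW : MemLp W 2 volume := (((L a).add (L c)).add (vv.const_mul (1 / 2))).add vψ
  have LR : MemLp R 2 volume := (L w).add hg
  have LRx : MemLp Rx 2 volume := (L _).add hgx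
  have LRy : MemLp Ry 2 volume := (L _).add hgy
  have dW (p : ℝ × ℝ) : HasDerivAt (fun x => W (x, p.2)) (-R p) p.1 := by
    refine (((a.hasDerivAt_fst p).add (c.hasDerivAt_fst p)).add
      (((v.hasDerivAt_fst p).mul (v.hasDerivAt_fst p)).const_mul (1 / 2))).add
      ((hasDerivAt_pdx hψ p).mul (v.hasDerivAt_fst p)) |>.congr_deriv ?_
    simp only [← hvx, hR, Prod.mk.eta]
    linear_combination heq' p
  have dRx (p : ℝ × ℝ) : HasDerivAt (fun x => R (x, p.2)) (Rx p) p.1 :=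
    (w.hasDerivAt_fst p).add (hasDerivAt_pdx hg' p)
  have dRy (p : ℝ × ℝ) : HasDerivAt (fun y => R (p.1, y)) (Ry p) p.2 :=
    (w.hasDerivAt_snd p).add (hasDerivAt_pdy hg' p)
  have ix : Integrable fun q => 2 * (a q * R q + vx q * Rx q) + 2 * (W q * -R q) :=
    (((I (L a) LR).add (I (L vx) LRx)).const_mul 2).add ((I LW LR.neg).const_mul 2)
  have iy : Integrable fun q => 2 * (c q * R q + vy q * Ry q) :=
    ((I (L c) LR).add (I (L vy) LRy)).const_mul 2
  have hx := integral_eq_zero_of_hasDerivAt_fst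
    (h := fun q => 2 * (vx q * R q) + W q * W q)
    (h' := fun q => 2 * (a q * R q + vx q * Rx q) + 2 * (W q * -R q))
    (fun p => by
      refine ((((vx.hasDerivAt_fst p).mul (dRx p)).const_mul 2).add
        ((dW p).mul (dW p))).congr_deriv ?_
      simp only [Prod.mk.eta, ← ha]
      ring)
    (((I (L vx) LR).const_mul 2).add (I LW LW)) ix
  have hy := integral_eq_zero_of_hasDerivAt_snd
    (h := fun q => 2 * (vy q * R q)) (h' := fun q => 2 * (c q * R q + vy q * Ry q))
    (fun p => ((vy.hasDerivAt_snd p).mul (dRy p)).const_mul 2)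
    ((I (L vy) LR).const_mul 2) iy
  have ir : Integrable fun q => -2 * (vx q * pdx g q) - 2 * (vy q * pdy g q) +
        (v q * v q) * g q + 2 * ((ψ q * v q) * g q) - v q * (χ q * v q) :=
    (((((I (L vx) hgx).const_mul (-2)).sub ((I (L vy) hgy).const_mul 2)).add (I vv hg)).add
      ((I vψ hg).const_mul 2)).sub (I (L v) vχ)
  exact integral_eq_of_eq_add_null (c := 1) (d := 1) ir ix iy hx hy fun q => by
    simp only [energyDensityDeriv, hW, hR, hRx, hRy]
    ring

end Identities

/-! ### Growth bounds for mass and energy -/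

section Bounds

variable {v w : SchwartzMap (ℝ × ℝ) ℝ} {ψ g χ : ℝ × ℝ → ℝ} {M K : ℝ}

/-- The squared `L²` norm of the gradient. -/
def gradSq (v : SchwartzMap (ℝ × ℝ) ℝ) : ℝ :=
  (∫ q, schwartzDx v q ^ 2) + ∫ q, schwartzDy v q ^ 2

lemma gradSq_nonneg (v : SchwartzMap (ℝ × ℝ) ℝ) : 0 ≤ gradSq v :=
  add_nonneg (integral_nonneg fun _ => sq_nonneg _) (integral_nonneg fun _ => sq_nonneg _)

lemma sq_integral_sq_mul_le (v : SchwartzMap (ℝ × ℝ) ℝ) (hg : MemLp g 2 volume) :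
    (∫ q, (v q * v q) * g q) ^ 2 ≤ 2 * (∫ q, v q ^ 2) * gradSq v * ∫ q, g q ^ 2 := by
  have h := sq_integral_mul_le ((v.memLp 2 volume).bounded_mul v.continuous v.abs_le) hg
  have h4 := v.ladyzhenskaya
  rw [v.pdx_eq, v.pdy_eq] at h4
  have : ∫ q, (v q * v q) ^ 2 = ∫ q, v q ^ 4 := by congr 1; ext q; ring
  rw [this] at h
  exact h.trans (mul_le_mul_of_nonneg_right h4 (integral_nonneg fun _ => sq_nonneg _))

theorem mass_bound (hψ : ContDiff ℝ ∞ ψ) (hψM : ∀ q, |ψ q| ≤ M) (hψK : ∀ q, |pdx ψ q| ≤ K)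
    (hg : MemLp g 2 volume) (hgM : ∫ q, g q ^ 2 ≤ M ^ 2)
    (heq : ∀ q, w q + pdx (pdx (pdx v)) q + pdx (pdy (pdy v)) q +
      (1 / 2) * pdx (fun q => v q ^ 2) q + pdx (fun q => v q * ψ q) q + g q = 0) :
    |∫ q, 2 * (v q * w q)| ≤ (K + 1) * (∫ q, v q ^ 2) + M ^ 2 := by
  rw [mass_identity hψ hψM hψK hg heq]
  have iv : Integrable fun q => v q ^ 2 := (v.memLp 2 volume).integrable_sq
  have ig : Integrable fun q => g q ^ 2 := hg.integrable_sq
  refine (abs_integral_le_of_abs_le (g := fun q => (K + 1) * v q ^ 2 + g q ^ 2)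
    ((iv.const_mul _).add ig) fun q => ?_).trans ?_
  · have h := abs_le.1 (hψK q)
    have h1 := mul_nonneg (sub_nonneg.2 h.2) (sq_nonneg (v q))
    have h2 := mul_nonneg (by linarith : 0 ≤ pdx ψ q + K) (sq_nonneg (v q))
    rw [abs_le]
    constructor <;> nlinarith [sq_nonneg (v q + g q), sq_nonneg (v q - g q)]
  · rw [integral_add (iv.const_mul _) ig, integral_const_mul]
    linarith

theorem energy_bound (hM : 0 ≤ M) (hψ : ContDiff ℝ ∞ ψ) (hψM : ∀ q, |ψ q| ≤ M)
    (hχ : Continuous χ) (hχM : ∀ q, |χ q| ≤ M) (hg' : ContDiff ℝ ∞ g)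
    (hg : MemLp g 2 volume) (hgx : MemLp (pdx g) 2 volume) (hgy : MemLp (pdy g) 2 volume)
    (hgM : ∫ q, g q ^ 2 ≤ M ^ 2) (hgxM : ∫ q, pdx g q ^ 2 ≤ M ^ 2)
    (hgyM : ∫ q, pdy g q ^ 2 ≤ M ^ 2)
    (heq : ∀ q, w q + pdx (pdx (pdx v)) q + pdx (pdy (pdy v)) q +
      (1 / 2) * pdx (fun q => v q ^ 2) q + pdx (fun q => v q * ψ q) q + g q = 0) :
    |∫ q, energyDensityDeriv v w ψ χ q| ≤
      (1 + M) * gradSq v + 3 * M * (∫ q, v q ^ 2) + 2 * M ^ 2 + M ^ 3 := by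
  rw [energy_identity hψ hψM hχ hχM hg' hg hgx hgy heq]
  have L (f : SchwartzMap (ℝ × ℝ) ℝ) : Integrable fun q => f q ^ 2 :=
    (f.memLp 2 volume).integrable_sq
  have ig : Integrable fun q => g q ^ 2 := hg.integrable_sq
  have igx : Integrable fun q => pdx g q ^ 2 := hgx.integrable_sq
  have igy : Integrable fun q => pdy g q ^ 2 := hgy.integrable_sq
  have ivg : Integrable fun q => (v q * v q) * |g q| :=
    ((v.memLp 2 volume).bounded_mul v.continuous v.abs_le).integrable_mul hg.abs
  set A := ∫ q, v q ^ 2 with hA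
  have hA0 : 0 ≤ A := integral_nonneg fun _ => sq_nonneg _
  have hD0 := gradSq_nonneg v
  have hcub : ∫ q, (v q * v q) * |g q| ≤ M * (A + gradSq v) := by
    have h := sq_integral_sq_mul_le (g := fun q => |g q|) v hg.abs
    simp only [sq_abs] at h
    refine abs_le_of_sq_le_sq' ?_ (by positivity) |>.2
    calc _ ≤ 2 * A * gradSq v * ∫ q, g q ^ 2 := h
      _ ≤ 2 * A * gradSq v * M ^ 2 := by gcongr
      _ ≤ (A + gradSq v) ^ 2 * M ^ 2 := by gcongr; nlinarith [sq_nonneg A, sq_nonneg (gradSq v)]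
      _ = _ := by ring
  have iD : Integrable fun q => schwartzDx v q ^ 2 + schwartzDy v q ^ 2 := (L _).add (L _)
  have igD : Integrable fun q => pdx g q ^ 2 + pdy g q ^ 2 := igx.add igy
  have i1 : Integrable fun q => (schwartzDx v q ^ 2 + schwartzDy v q ^ 2) +
      (pdx g q ^ 2 + pdy g q ^ 2) := iD.add igD
  have i2 : Integrable fun q => 2 * M * v q ^ 2 + M * g q ^ 2 :=
    ((L v).const_mul (2 * M)).add (ig.const_mul M)
  have i12 : Integrable fun q => ((schwartzDx v q ^ 2 + schwartzDy v q ^ 2) +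
      (pdx g q ^ 2 + pdy g q ^ 2)) + (2 * M * v q ^ 2 + M * g q ^ 2) := i1.add i2
  refine (abs_integral_le_of_abs_le (g := fun q => ((schwartzDx v q ^ 2 + schwartzDy v q ^ 2) +
    (pdx g q ^ 2 + pdy g q ^ 2)) + (2 * M * v q ^ 2 + M * g q ^ 2) + (v q * v q) * |g q|)
    (i12.add ivg) fun q => ?_).trans ?_
  · have b1 : |2 * (schwartzDx v q * pdx g q)| ≤ schwartzDx v q ^ 2 + pdx g q ^ 2 := by
      rw [abs_le]
      constructor <;> nlinarith [sq_nonneg (schwartzDx v q + pdx g q),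
        sq_nonneg (schwartzDx v q - pdx g q)]
    have b2 : |2 * (schwartzDy v q * pdy g q)| ≤ schwartzDy v q ^ 2 + pdy g q ^ 2 := by
      rw [abs_le]
      constructor <;> nlinarith [sq_nonneg (schwartzDy v q + pdy g q),
        sq_nonneg (schwartzDy v q - pdy g q)]
    have b3 : |(v q * v q) * g q| = (v q * v q) * |g q| := by
      rw [abs_mul, abs_mul_self]
    have b4 : |2 * ((ψ q * v q) * g q)| ≤ M * (v q ^ 2 + g q ^ 2) := by
      have e : 2 * ((ψ q * v q) * g q) = ψ q * (2 * (v q * g q)) := by ring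
      rw [e, abs_mul]
      refine mul_le_mul (hψM q) ?_ (abs_nonneg _) hM
      rw [abs_le]
      constructor <;> nlinarith [sq_nonneg (v q + g q), sq_nonneg (v q - g q)]
    have b5 : |v q * (χ q * v q)| ≤ M * v q ^ 2 := by
      have e : v q * (χ q * v q) = χ q * v q ^ 2 := by ring
      rw [e, abs_mul, abs_of_nonneg (sq_nonneg (v q))]
      exact mul_le_mul_of_nonneg_right (hχM q) (sq_nonneg _)
    have b3' := b3.le
    rw [abs_le] at b1 b2 b3' b4 b5 ⊢
    constructor <;> linarith [b1.1, b1.2, b2.1, b2.2, b3'.1, b3'.2, b4.1, b4.2, b5.1, b5.2]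
  · have e : ∫ q, (((schwartzDx v q ^ 2 + schwartzDy v q ^ 2) + (pdx g q ^ 2 + pdy g q ^ 2)) +
        (2 * M * v q ^ 2 + M * g q ^ 2) + (v q * v q) * |g q|) =
        gradSq v + ((∫ q, pdx g q ^ 2) + ∫ q, pdy g q ^ 2) + (2 * M * A + M * ∫ q, g q ^ 2) +
        ∫ q, (v q * v q) * |g q| := by
      rw [integral_add i12 ivg, integral_add i1 i2, integral_add iD igD,
        integral_add (L (schwartzDx v)) (L (schwartzDy v)), integral_add igx igy,
        integral_add ((L v).const_mul (2 * M)) (ig.const_mul M), integral_const_mul,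
        integral_const_mul]
      rfl
    rw [e]
    have := mul_le_mul_of_nonneg_left hgM hM
    linarith

/-- The modified energy controls the gradient and conversely, up to the mass. -/
theorem energy_equiv_gradSq (hψ : Continuous ψ) (hψM : ∀ q, |ψ q| ≤ M) :
    |(∫ q, energyDensity v ψ q) - gradSq v| ≤
      gradSq v / 2 + (∫ q, v q ^ 2) ^ 2 / 9 + M * ∫ q, v q ^ 2 := by
  have L (f : SchwartzMap (ℝ × ℝ) ℝ) : Integrable fun q => f q ^ 2 :=
    (f.memLp 2 volume).integrable_sq
  have i3 : Integrable fun q => (v q * v q) * v q :=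
    ((v.memLp 2 volume).bounded_mul v.continuous v.abs_le).integrable_mul (v.memLp 2 volume)
  have i4 : Integrable fun q => ψ q * v q * v q :=
    ((v.memLp 2 volume).bounded_mul hψ hψM).integrable_mul (v.memLp 2 volume)
  set A := ∫ q, v q ^ 2 with hA
  have hA0 : 0 ≤ A := integral_nonneg fun _ => sq_nonneg _
  have hD0 := gradSq_nonneg v
  have e : ∫ q, energyDensity v ψ q =
      gradSq v - (1 / 3) * (∫ q, (v q * v q) * v q) - ∫ q, ψ q * v q * v q := by
    have e1 : energyDensity v ψ = fun q => (schwartzDx v q ^ 2 + schwartzDy v q ^ 2) -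
        (1 / 3) * ((v q * v q) * v q) - ψ q * v q * v q := by
      ext q; unfold energyDensity; ring
    have iD : Integrable fun q => schwartzDx v q ^ 2 + schwartzDy v q ^ 2 := (L _).add (L _)
    have iD3 : Integrable fun q => schwartzDx v q ^ 2 + schwartzDy v q ^ 2 -
        (1 / 3) * ((v q * v q) * v q) := iD.sub (i3.const_mul _)
    rw [e1, integral_sub iD3 i4, integral_sub iD (i3.const_mul _), integral_add (L _) (L _),
      integral_const_mul]
    rfl
  have h4 : |∫ q, ψ q * v q * v q| ≤ M * A := by
    rw [hA, ← integral_const_mul]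
    refine abs_integral_le_of_abs_le ((L v).const_mul M) fun q => ?_
    rw [mul_assoc, abs_mul, abs_mul_self, ← pow_two]
    exact mul_le_mul_of_nonneg_right (hψM q) (sq_nonneg _)
  have h3 : |(1 / 3) * ∫ q, (v q * v q) * v q| ≤ gradSq v / 2 + A ^ 2 / 9 := by
    apply abs_le_of_sq_le_sq _ (by positivity)
    have := sq_integral_sq_mul_le v (v.memLp 2 volume)
    nlinarith [sq_nonneg (gradSq v / 2 - A ^ 2 / 9)]
  rw [e]
  rw [abs_le] at *
  constructor <;> linarith [h3.1, h3.2, h4.1, h4.2]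

end Bounds

/-! ### The Grönwall argument -/

lemma le_mul_exp_of_deriv_le {F F' : ℝ → ℝ} {C T : ℝ} (hc : ContinuousOn F (Set.Icc 0 T))
    (hd : ∀ t ∈ Set.Ioo 0 T, HasDerivAt F (F' t) t) (hle : ∀ t ∈ Set.Ioo 0 T, F' t ≤ C * F t)
    {t : ℝ} (ht : t ∈ Set.Icc 0 T) : F t ≤ F 0 * Real.exp (C * t) := by
  have hd' (t : ℝ) (ht : t ∈ Set.Ioo 0 T) : HasDerivAt (fun s => F s * Real.exp (-(C * s)))
      ((F' t - C * F t) * Real.exp (-(C * t))) t := by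
    have h2 : HasDerivAt (fun s => Real.exp (-(C * s))) (Real.exp (-(C * t)) * -(C * 1)) t :=
      (((hasDerivAt_id t).const_mul C).neg).exp
    exact ((hd t ht).mul h2).congr_deriv (by ring)
  have hanti : AntitoneOn (fun s => F s * Real.exp (-(C * s))) (Set.Icc 0 T) := by
    apply antitoneOn_of_deriv_nonpos (convex_Icc 0 T) (hc.mul (by fun_prop))
    · rw [interior_Icc]
      exact fun t ht => (hd' t ht).differentiableAt.differentiableWithinAt
    · rw [interior_Icc]
      intro t ht
      refine (hd' t ht).deriv.trans_le ?_
      exact mul_nonpos_of_nonpos_of_nonneg (by linarith [hle t ht]) (Real.exp_pos _).le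
  have h := hanti (Set.left_mem_Icc.2 (ht.1.trans ht.2)) ht ht.1
  simp only [mul_zero, neg_zero, Real.exp_zero, mul_one] at h
  rw [Real.exp_neg, ← div_eq_mul_inv, div_le_iff₀ (Real.exp_pos _)] at h
  exact h

lemma contDiff_bgG {Ψ : ℝ × (ℝ × ℝ) → ℝ} (hΨ : ContDiff ℝ ∞ Ψ) (t : ℝ) :
    ContDiff ℝ ∞ (bgG Ψ t) := by
  have h : ContDiff ℝ ∞ fun q => Ψ (t, q) := hΨ.comp (contDiff_const.prodMk contDiff_id)
  exact (((contDiff_deriv_time hΨ t).add (contDiff_pdx (contDiff_pdx (contDiff_pdx h)))).add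
    (contDiff_pdx (contDiff_pdy (contDiff_pdy h)))).add
    (contDiff_const.mul (contDiff_pdx (h.pow 2)))

lemma memLp_and_integral_sq_le {g : ℝ × ℝ → ℝ} {M : ℝ} (hM : 0 ≤ M) (hc : Continuous g)
    (h : eLpNorm g 2 volume ≤ ENNReal.ofReal M) :
    MemLp g 2 volume ∧ ∫ q, g q ^ 2 ≤ M ^ 2 := by
  have hm : MemLp g 2 volume := ⟨hc.aestronglyMeasurable, h.trans_lt ENNReal.ofReal_lt_top⟩
  refine ⟨hm, ?_⟩
  rw [← eLpNorm_two_toReal_sq hm]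
  have := ENNReal.toReal_mono ENNReal.ofReal_ne_top h
  rw [ENNReal.toReal_ofReal hM] at this
  gcongr

lemma sobH1_sq (v : SchwartzMap (ℝ × ℝ) ℝ) :
    sobH1 v ^ 2 = (∫ q, v q ^ 2) + gradSq v := by
  unfold sobH1
  rw [Real.sq_sqrt (by positivity), v.pdx_eq, v.pdy_eq, eLpNorm_two_toReal_sq (v.memLp 2 volume),
    eLpNorm_two_toReal_sq ((schwartzDx v).memLp 2 volume),
    eLpNorm_two_toReal_sq ((schwartzDy v).memLp 2 volume), add_assoc]
  rfl

theorem stmt15 :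
    ∀ M : ℝ, 0 < M →
    ∃ C : ℝ, 0 < C ∧
      ∀ T : ℝ, 0 < T →
      ∀ u u' : ℝ → SchwartzMap (ℝ × ℝ) ℝ,
        -- `t ↦ u(t)` is continuously differentiable from `[0,T]` into 𝒮(ℝ²)
        (∀ t ∈ Set.Icc (0 : ℝ) T,
          Filter.Tendsto (fun s => (s - t)⁻¹ • (u s - u t))
            (nhdsWithin t (Set.Icc (0 : ℝ) T \ {t})) (nhds (u' t))) →
        ContinuousOn u' (Set.Icc (0 : ℝ) T) →
      ∀ Ψ : ℝ × (ℝ × ℝ) → ℝ, ContDiff ℝ (⊤ : ℕ∞) Ψ →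
        -- Ψ has all derivatives up to second order bounded
        (∃ B : ℝ, ∀ z, |Ψ z| ≤ B ∧ ‖fderiv ℝ Ψ z‖ ≤ B ∧
          ‖fderiv ℝ (fderiv ℝ Ψ) z‖ ≤ B) →
        -- size assumptions in terms of M
        sobH1 (⇑(u 0)) ≤ M →
        (∀ z, |Ψ z| ≤ M) →
        (∀ z : ℝ × (ℝ × ℝ), |deriv (fun s => Ψ (s, z.2)) z.1| ≤ M) →
        (∀ t ∈ Set.Icc (0 : ℝ) T,
          eLpNorm (bgG Ψ t) 2 volume ≤ ENNReal.ofReal M ∧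
          eLpNorm (pdx (bgG Ψ t)) 2 volume ≤ ENNReal.ofReal M ∧
          eLpNorm (pdy (bgG Ψ t)) 2 volume ≤ ENNReal.ofReal M ∧
          eLpNorm (pdx (pdx (bgG Ψ t))) 2 volume ≤ ENNReal.ofReal M ∧
          eLpNorm (pdx (pdy (bgG Ψ t))) 2 volume ≤ ENNReal.ofReal M ∧
          eLpNorm (pdy (pdy (bgG Ψ t))) 2 volume ≤ ENNReal.ofReal M) →
        -- the Zakharov–Kuznetsov equation on the background Ψ
        (∀ t ∈ Set.Icc (0 : ℝ) T, ∀ q : ℝ × ℝ,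
          u' t q + pdx (pdx (pdx ⇑(u t))) q + pdx (pdy (pdy ⇑(u t))) q +
              (1 / 2) * pdx (fun q' => u t q' ^ 2) q +
              pdx (fun q' => u t q' * Ψ (t, q')) q + bgG Ψ t q = 0) →
      ∀ t ∈ Set.Icc (0 : ℝ) T,
        sobH1 (⇑(u t)) ≤ C * Real.exp (C * t) := by
  intro M hM
  obtain ⟨K, hK, hKb⟩ := exists_bound_pdx hM
  set C₀ := 2 * (1 + M) + 3 * M + 2 * M ^ 2 + M ^ 3 + (4 * (K + 1) + 4 * M ^ 2) +
    (M * (K + 1) + M ^ 3) with hC₀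
  set F₀ := (3 / 2) * M ^ 2 + (M ^ 2) ^ 2 / 9 + M * M ^ 2 + 2 * (M ^ 2) ^ 2 + M * M ^ 2 + 1 with hF₀
  have hC₀pos : 0 < C₀ := by positivity
  have hF₀one : 1 ≤ F₀ := by
    have : 0 ≤ (3 / 2) * M ^ 2 + (M ^ 2) ^ 2 / 9 + M * M ^ 2 + 2 * (M ^ 2) ^ 2 + M * M ^ 2 := by
      positivity
    linarith
  refine ⟨3 * F₀ + C₀, by positivity, ?_⟩
  intro T hT u u' hdu hu' Ψ hΨ _ h0 hΨM hΨt hG heq t ht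
  have hψ (t : ℝ) : ContDiff ℝ ∞ fun q => Ψ (t, q) :=
    hΨ.comp (contDiff_const.prodMk contDiff_id)
  have hψt (t : ℝ) := contDiff_deriv_time hΨ t
  have hg (t : ℝ) := contDiff_bgG hΨ t
  obtain ⟨⟨hAc, hAd⟩, hEc, hEd⟩ := mass_energy_regularity hdu hu' hΨ hM.le hΨM hΨt
  set A : ℝ → ℝ := fun t => ∫ q, u t q ^ 2 with hA
  set E : ℝ → ℝ := fun t => ∫ q, energyDensity (u t) (fun q => Ψ (t, q)) q with hE
  set D : ℝ → ℝ := fun t => gradSq (u t) with hD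
  have hA0 (t : ℝ) : 0 ≤ A t := integral_nonneg fun _ => sq_nonneg _
  have hD0 (t : ℝ) : 0 ≤ D t := gradSq_nonneg _
  have hequiv (t : ℝ) : |E t - D t| ≤ D t / 2 + A t ^ 2 / 9 + M * A t :=
    energy_equiv_gradSq (hψ t).continuous fun q => hΨM (t, q)
  set F : ℝ → ℝ := fun t => E t + 2 * A t ^ 2 + M * A t + 1 with hF
  have hFlow (t : ℝ) : D t / 2 + A t ^ 2 + 1 ≤ F t := by
    have := (abs_le.1 (hequiv t)).1
    simp only [hF]
    nlinarith [sq_nonneg (A t)]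
  have hF0 : F 0 ≤ F₀ := by
    have hs : A 0 + D 0 ≤ M ^ 2 := by
      rw [hA, hD, ← sobH1_sq]
      exact pow_le_pow_left₀ (Real.sqrt_nonneg _) h0 2
    have hAM : A 0 ≤ M ^ 2 := by linarith [hD0 0]
    have hDM : D 0 ≤ M ^ 2 := by linarith [hA0 0]
    have hA2 : A 0 ^ 2 ≤ (M ^ 2) ^ 2 := pow_le_pow_left₀ (hA0 0) hAM 2
    have hMA : M * A 0 ≤ M * M ^ 2 := mul_le_mul_of_nonneg_left hAM hM.le
    have := (abs_le.1 (hequiv 0)).2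
    simp only [hF, hF₀]
    linarith
  have hgrow (t : ℝ) (ht : t ∈ Set.Ioo 0 T) :
      (∫ q, energyDensityDeriv (u t) (u' t) (fun q => Ψ (t, q))
        (fun q => deriv (fun s => Ψ (s, q)) t) q) + 4 * A t * (∫ q, 2 * (u t q * u' t q)) +
        M * (∫ q, 2 * (u t q * u' t q)) ≤ C₀ * F t := by
    have htc := Set.Ioo_subset_Icc_self ht
    obtain ⟨g0, gx, gy, -⟩ := hG t htc
    obtain ⟨l0, b0⟩ := memLp_and_integral_sq_le hM.le (hg t).continuous g0
    obtain ⟨lx, bx⟩ := memLp_and_integral_sq_le hM.le (contDiff_pdx (hg t)).continuous gx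
    obtain ⟨ly, bY⟩ := memLp_and_integral_sq_le hM.le (contDiff_pdy (hg t)).continuous gy
    have hΨx : ∀ p, |pdx (fun q => Ψ (t, q)) p| ≤ K :=
      hKb _ (bgG Ψ t) (fun q => -deriv (fun s => Ψ (s, q)) t) (hψ t) (hg t).continuous
        (hψt t).continuous.neg (fun q => hΨM (t, q)) l0.integrable_sq b0
        (fun q => by rw [abs_neg]; exact hΨt (t, q)) (fun q => by simp only [bgG]; ring)
    have hm := (abs_le.1 (mass_bound (hψ t) (fun q => hΨM (t, q)) hΨx l0 b0 (heq t htc))).2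
    have he := (abs_le.1 (energy_bound hM.le (hψ t) (fun q => hΨM (t, q)) (hψt t).continuous
      (fun q => hΨt (t, q)) (hg t) l0 lx ly b0 bx bY (heq t htc))).2
    change _ ≤ (K + 1) * A t + M ^ 2 at hm
    change _ ≤ (1 + M) * D t + 3 * M * A t + 2 * M ^ 2 + M ^ 3 at he
    have hl := hFlow t
    have a0 := hA0 t
    have d0 := hD0 t
    have fD : D t ≤ 2 * F t := by nlinarith
    have fA2 : A t ^ 2 ≤ F t := by nlinarith
    have f1 : 1 ≤ F t := by nlinarith
    have fA : A t ≤ F t := by nlinarith [sq_nonneg (A t - 1)]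
    have m1 := mul_le_mul_of_nonneg_left hm (by positivity : 0 ≤ 4 * A t)
    have m2 := mul_le_mul_of_nonneg_left hm hM.le
    have n1 := mul_le_mul_of_nonneg_left fD (by positivity : 0 ≤ 1 + M)
    have n2 := mul_le_mul_of_nonneg_left fA (by positivity : 0 ≤ 3 * M)
    have n3 := mul_le_mul_of_nonneg_left f1 (by positivity : 0 ≤ 2 * M ^ 2 + M ^ 3 + M ^ 3)
    have n4 := mul_le_mul_of_nonneg_left fA2 (by positivity : 0 ≤ 4 * (K + 1))
    have n5 := mul_le_mul_of_nonneg_left fA (by positivity : 0 ≤ 4 * M ^ 2 + M * (K + 1))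
    rw [hC₀]
    linarith
  have hFd (t : ℝ) (ht : t ∈ Set.Ioo 0 T) := ((((hEd t ht).add
    (((hAd t ht).pow 2).const_mul 2)).add ((hAd t ht).const_mul M)).add_const 1)
  have hFt : F t ≤ F 0 * Real.exp (C₀ * t) :=
    le_mul_exp_of_deriv_le
      (((hEc.add (continuousOn_const.mul (hAc.pow 2))).add (continuousOn_const.mul hAc)).add
        continuousOn_const) hFd (fun t ht => le_of_eq_of_le (by simp; ring) (hgrow t ht)) ht
  have hexp : 1 ≤ Real.exp (C₀ * t) := Real.one_le_exp (mul_nonneg hC₀pos.le ht.1)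
  have hX : 1 ≤ 3 * F₀ * Real.exp (C₀ * t) := by nlinarith
  have hsq : sobH1 (u t) ^ 2 ≤ (3 * F₀ * Real.exp (C₀ * t)) ^ 2 := by
    rw [sobH1_sq]
    change A t + D t ≤ _
    have hl := hFlow t
    have := mul_le_mul_of_nonneg_right hF0 (Real.exp_pos (C₀ * t)).le
    nlinarith [sq_nonneg (A t - 1), hD0 t]
  calc sobH1 (u t) ≤ 3 * F₀ * Real.exp (C₀ * t) := le_of_sq_le_sq hsq (by positivity)
    _ ≤ (3 * F₀ + C₀) * Real.exp ((3 * F₀ + C₀) * t) := by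
        have := ht.1
        gcongr
        · linarith
        · linarith
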